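/- For every β∈Δ⁺, s∈ℤ, and for any choices of the parameters λ∈v^ℤ and decompositions defining the quantum root vector E_{β,s}, there exist c∈ℚ^× and m∈ℤ such that φ_β(Ψ(E_{β,s})) = c·v^m·⟨1⟩_v^{|β|−1}·w_{β,1}^{s+|β|−1}. -/

import Mathlib

noncomputable section
open scoped BigOperators DirectSum

/-! ### Base field ℚ(v) and quantum numbers -/

/-- the base field `ℚ(v)`. -/
abbrev KK : Type := RatFunc ℚ
/-- the variable `v ∈ ℚ(v)`. -/
def vv : KK := RatFunc.X
/-- integer powers of `v`. -/
def vpow (m : ℤ) : KK := vv ^ m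
/-- the quantum integer `[m]_u = (uᵐ - u⁻ᵐ)/(u - u⁻¹)`. -/
def qInt (u : KK) (m : ℕ) : KK := (u ^ (m : ℤ) - u ^ (-(m : ℤ))) / (u - u⁻¹)
/-- the quantum factorial `[m]_u!`. -/
def qFact (u : KK) (m : ℕ) : KK := ∏ k ∈ Finset.range m, qInt u (k + 1)
/-- the quantum binomial coefficient. -/
def qBinom (u : KK) (m k : ℕ) : KK := qFact u m / (qFact u k * qFact u (m - k))
/-- `⟨m⟩_v = vᵐ - v⁻ᵐ`. -/
def qBrack (m : ℕ) : KK := vpow (m : ℤ) - vpow (-(m : ℤ))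
/-- the sign `ε ∈ {+,-}` as `±1`. -/
def sgn (ε : Bool) : ℤ := if ε then 1 else -1
/-- `l` is an integer power of `v`. -/
def IsVpow (l : KK) : Prop := ∃ m : ℤ, l = vpow m

/-! ### Cartan data of types `C_n` and `D_n` (1-based indices) -/

/-- the Cartan matrix of type `C_n` (1-based indices). -/
def aC (n i j : ℕ) : ℤ :=
  if i = j then 2 else if i + 1 = n ∧ j = n then -2
  else if i + 1 = j ∨ j + 1 = i then -1 else 0
/-- the symmetrizing integers `d_i` of type `C_n`. -/
def dC (n i : ℕ) : ℕ := if i = n then 2 else 1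
/-- the Cartan matrix of type `D_n` (1-based indices). -/
def aD (n i j : ℕ) : ℤ :=
  if i = j then 2
  else if (i + 1 = j ∧ j + 1 ≤ n) ∨ (j + 1 = i ∧ i + 1 ≤ n) then -1
  else if (i + 2 = n ∧ j = n) ∨ (j + 2 = n ∧ i = n) then -1 else 0
/-- the symmetrizing integers `d_i` of type `D_n` (all equal to `1`). -/
def dD (n i : ℕ) : ℕ := 1

/-! ### The positive subalgebra of the quantum loop algebra, for Cartan data `(A, Dd)` -/

section Ualg
variable (n : ℕ) (A : ℕ → ℕ → ℤ) (Dd : ℕ → ℕ)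

/-- the free `ℚ(v)`-algebra on generators `e_{i,r}`, `i ∈ I`, `r ∈ ℤ`. -/
abbrev FA := FreeAlgebra KK (Fin n × ℤ)
/-- the free generator `e_{i,r}`. -/
def fg (i : Fin n) (r : ℤ) : FA n := FreeAlgebra.ι KK (i, r)

/-- the `z^{-r₁}⋯z^{-r_m}w^{-t}`-coefficient of the Serre relation between colors `i ≠ j`. -/
def serreElt (i j : Fin n) (m : ℕ) (r : Fin m → ℤ) (t : ℤ) : FA n :=
  ∑ σ : Equiv.Perm (Fin m), ∑ k ∈ Finset.range (m + 1),
    ((-1 : KK) ^ k * qBinom (vpow (Dd (i.1 + 1))) m k) •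
      (((List.ofFn fun l => fg n i (r (σ l))).take k
        ++ fg n j t :: (List.ofFn fun l => fg n i (r (σ l))).drop k).prod)

/-- the defining relations of `U_v^>(Lg)` in the new Drinfeld realization: the coefficients of
`(z - v_i^{a_ij} w) e_i(z) e_j(w) = (v_i^{a_ij} z - w) e_j(w) e_i(z)` and of the Serre relations. -/
inductive URel : FA n → FA n → Prop
  | loop (i j : Fin n) (r s : ℤ) :
      URel (fg n i (r + 1) * fg n j s
             - vpow ((Dd (i.1 + 1) : ℤ) * A (i.1 + 1) (j.1 + 1)) • (fg n i r * fg n j (s + 1)))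
           (vpow ((Dd (i.1 + 1) : ℤ) * A (i.1 + 1) (j.1 + 1)) • (fg n j s * fg n i (r + 1))
             - fg n j (s + 1) * fg n i r)
  | serre (i j : Fin n) (hij : i ≠ j) (r : Fin (1 - A (i.1 + 1) (j.1 + 1)).toNat → ℤ) (t : ℤ) :
      URel (serreElt n Dd i j _ r t) 0

/-- the positive subalgebra `U_v^>(Lg)` of the quantum loop algebra. -/
abbrev UA := RingQuot (URel n A Dd)
/-- the generator `e_{i,r}` of `U_v^>(Lg)`. -/
def ug (i : Fin n) (r : ℤ) : UA n A Dd := RingQuot.mkAlgHom KK (URel n A Dd) (fg n i r)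
/-- the generator `e_{i,r}` with a 1-based index `1 ≤ i ≤ n` (and junk value `0` otherwise). -/
def g1 (i : ℕ) (r : ℤ) : UA n A Dd := if h : 1 ≤ i ∧ i ≤ n then ug n A Dd ⟨i - 1, by omega⟩ r else 0

end Ualg

/-! ### `q`-brackets, ordered monomials, and ℤ[v,v⁻¹]-forms -/

section Aux
variable {B : Type} [Ring B] [Module KK B]

/-- the `u`-commutator `[x,y]_u = xy - u · yx`. -/
def qcm (u : KK) (x y : B) : B := x * y - u • (y * x)

/-- the iterated `q`-bracket `[⋯[[g i₁ s₁, g i₂ s₂]_{λ₁}, g i₃ s₃]_{λ₂}, ⋯]_{λ_{ℓ-1}}`. -/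
def chainE (g : ℕ → ℤ → B) (w : List ℕ) (ss : List ℤ) (ls : List KK) : B :=
  match w, ss with
  | i :: w', s :: ss' =>
      ((w'.zip ss').zip ls).foldl
        (fun acc p => acc * g p.1.1 p.1.2 - p.2 • (g p.1.1 p.1.2 * acc)) (g i s)
  | _, _ => 0
end Aux

section Mon
variable {B : Type} [Ring B] {ι : Type} [LinearOrder ι]
/-- the ordered monomial `∏→ (E p)^(h p)`, the product taken in increasing order of `p`. -/
def ordMon (E : ι → B) (h : ι →₀ ℕ) : B := ((h.support.sort (· ≤ ·)).map (fun p => E p ^ h p)).prod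
end Mon

/-- the subring `ℤ[v,v⁻¹] ⊆ ℚ(v)`. -/
def Rint : Subring KK := Subring.closure {vv, vv⁻¹}

section Forms
variable {B : Type} [Ring B] [Algebra KK B]
/-- the `ℤ[v,v⁻¹]`-subalgebra of a `ℚ(v)`-algebra generated by a set `X`, realized as the subring
generated by `X` together with the central scalars `v^{±1}`. -/
def zvForm (X : Set B) : Subring B :=
  Subring.closure ({algebraMap KK B vv, algebraMap KK B vv⁻¹} ∪ X)
end Forms

/-! ### Positive roots of type `D_n` with the fixed convex (lexicographic) order -/

section RootsD
variable (n : ℕ)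

/-- Positive roots of type `D_n`, encoded as lexicographically ordered pairs `(i,t)`:
`[i,i+t]` for `i+t<n` or `i=n`; `[i,n]` for `i+t=n`; `[i,n,n-1]` for `i+t=n+1`;
`[i,n,j]` with `j = 2n-i-t` for `i+t ≥ n+2`.  The induced linear order is exactly the
convex order coming from standard Lyndon words. -/
def IsPosRootD (p : Fin (n + 1) ×ₗ Fin (2 * n + 1)) : Prop :=
  1 ≤ ((ofLex p).1 : ℕ) ∧ (n - 1 ≤ ((ofLex p).1 : ℕ) → ((ofLex p).2 : ℕ) = 0) ∧
    (((ofLex p).2 : ℕ) = 0 ∨ ((ofLex p).2 : ℕ) + 2 * ((ofLex p).1 : ℕ) + 1 ≤ 2 * n)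

instance : DecidablePred (IsPosRootD n) := fun p => by unfold IsPosRootD; infer_instance

/-- the set `Δ⁺` of positive roots of type `D_n`, with its convex linear order. -/
abbrev PosRootD := {p : Fin (n + 1) ×ₗ Fin (2 * n + 1) // IsPosRootD n p}

variable {n}
/-- the first index `i` of a positive root. -/
def riD (β : PosRootD n) : ℕ := ((ofLex β.1).1 : ℕ)
/-- the offset `t` of a positive root within its block. -/
def rtD (β : PosRootD n) : ℕ := ((ofLex β.1).2 : ℕ)

/-- multiplicity of `α_c` (1-based color `c`) in the positive root `β` (type `D_n`). -/
def nuD (β : PosRootD n) (c : ℕ) : ℕ :=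
  let i := riD β; let t := rtD β
  if i + t < n ∨ i = n then (if i ≤ c ∧ c ≤ i + t then 1 else 0)
  else if i + t = n then (if (i ≤ c ∧ c ≤ n - 2) ∨ c = n then 1 else 0)
  else if i + t = n + 1 then (if i ≤ c ∧ c ≤ n then 1 else 0)
  else (if i ≤ c ∧ c < 2 * n - i - t then 1
        else if 2 * n - i - t ≤ c ∧ c ≤ n - 2 then 2
        else if c = n - 1 ∨ c = n then 1 else 0)

/-- standard Lyndon word (list of 1-based simple-root indices) of `β` (type `D_n`). -/
def wordD (β : PosRootD n) : List ℕ :=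
  let i := riD β; let t := rtD β
  if i + t < n ∨ i = n then List.range' i (t + 1)
  else if i + t = n then List.range' i (n - 1 - i) ++ [n]
  else if i + t = n + 1 then List.range' i (n - 1 - i) ++ [n, n - 1]
  else List.range' i (n - 1 - i) ++ [n] ++ (List.range' (2 * n - i - t) (n - (2 * n - i - t))).reverse

/-- the height `|β|` of a positive root (type `D_n`). -/
def heightD (β : PosRootD n) : ℕ := (wordD β).length

/-- `β` is a root of the form `[i,n,j]` with `i < j ≤ n-2`. -/
def isSpecD (β : PosRootD n) : Prop := n + 2 ≤ riD β + rtD β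
instance (β : PosRootD n) : Decidable (isSpecD β) := by unfold isSpecD; infer_instance
end RootsD

/-! ### General quantum root vectors of type `D_n` -/

section RVD
variable (n : ℕ)

/-- the positive subalgebra `U_v^>(Lo_{2n})`. -/
abbrev UD := UA n (aD n) (dD n)
/-- generators of `U_v^>(Lo_{2n})` with 1-based indices. -/
def genD : ℕ → ℤ → UD n := g1 n (aD n) (dD n)

variable {n}
/-- `E` is a quantum root vector `E_{β,s}` of type `D_n` for some choice of the parameters
`λ_k ∈ v^ℤ` and of a decomposition of `s`: an iterated `q`-bracket along the standard Lyndon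
word of `β`. -/
def IsRVD (β : PosRootD n) (s : ℤ) (E : UD n) : Prop :=
  ∃ (ss : List ℤ) (ls : List KK),
    ss.length = (wordD β).length ∧ ls.length + 1 = (wordD β).length ∧ ss.sum = s ∧
    (∀ l ∈ ls, IsVpow l) ∧ E = chainE (genD n) (wordD β) ss ls
end RVD

section Shuffle
variable (n : ℕ) (A : ℕ → ℕ → ℤ) (Dd : ℕ → ℕ)

abbrev Vars (k : Fin n → ℕ) : Type := Σ i : Fin n, Fin (k i)
abbrev Pk (k : Fin n → ℕ) := MvPolynomial (Vars n k) KK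
abbrev Fk (k : Fin n → ℕ) := FractionRing (Pk n k)

def xvr {k : Fin n → ℕ} (u : Vars n k) : Fk n k := algebraMap (Pk n k) (Fk n k) (MvPolynomial.X u)
def cf {k : Fin n → ℕ} (a : KK) : Fk n k := algebraMap KK (Fk n k) a

def emb1f (k l : Fin n → ℕ) : Vars n k → Vars n (k + l) :=
  fun u => ⟨u.1, ⟨u.2.1, by have h := u.2.2; show u.2.1 < k u.1 + l u.1; omega⟩⟩
def emb2f (k l : Fin n → ℕ) : Vars n l → Vars n (k + l) :=
  fun u => ⟨u.1, ⟨k u.1 + u.2.1, by have h := u.2.2; show k u.1 + u.2.1 < k u.1 + l u.1; omega⟩⟩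

lemma emb1f_inj (k l : Fin n → ℕ) : Function.Injective (emb1f n k l) := by
  rintro ⟨i, r⟩ ⟨j, s⟩ h
  simp only [emb1f, Sigma.mk.inj_iff] at h
  obtain ⟨rfl, h2⟩ := h
  rw [heq_iff_eq, Fin.mk.injEq] at h2
  exact congrArg _ (Fin.ext h2)

lemma emb2f_inj (k l : Fin n → ℕ) : Function.Injective (emb2f n k l) := by
  rintro ⟨i, r⟩ ⟨j, s⟩ h
  simp only [emb2f, Sigma.mk.inj_iff] at h
  obtain ⟨rfl, h2⟩ := h
  rw [heq_iff_eq, Fin.mk.injEq] at h2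
  exact congrArg _ (Fin.ext (by omega))

def permVf {m : Fin n → ℕ} (σ : ∀ i, Equiv.Perm (Fin (m i))) : Vars n m → Vars n m :=
  fun u => ⟨u.1, σ u.1 u.2⟩

lemma permVf_inj {m : Fin n → ℕ} (σ : ∀ i, Equiv.Perm (Fin (m i))) :
    Function.Injective (permVf n σ) := by
  rintro ⟨i, r⟩ ⟨j, s⟩ h
  simp only [permVf, Sigma.mk.inj_iff] at h
  obtain ⟨rfl, h2⟩ := h
  rw [heq_iff_eq] at h2
  exact congrArg _ ((σ i).injective h2)

/-- extension of an (injective) renaming of variables to fraction fields. -/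
def liftHom {k m : Fin n → ℕ} (f : Vars n k → Vars n m) (hf : Function.Injective f) :
    Fk n k →+* Fk n m :=
  IsFractionRing.lift (g := (algebraMap (Pk n m) (Fk n m)).comp
      (MvPolynomial.rename f).toRingHom)
    (by
      rw [RingHom.coe_comp]
      exact Function.Injective.comp (IsFractionRing.injective _ _)
        (by simpa using MvPolynomial.rename_injective (R := KK) f hf))

def emb1 (k l : Fin n → ℕ) : Fk n k →+* Fk n (k + l) := liftHom n (emb1f n k l) (emb1f_inj n k l)
def emb2 (k l : Fin n → ℕ) : Fk n l →+* Fk n (k + l) := liftHom n (emb2f n k l) (emb2f_inj n k l)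
def permF {m : Fin n → ℕ} (σ : ∀ i, Equiv.Perm (Fin (m i))) : Fk n m →+* Fk n m :=
  liftHom n (permVf n σ) (permVf_inj n σ)

/-- the product of `ζ`-factors in the shuffle product. -/
def zfac (k l : Fin n → ℕ) : Fk n (k + l) :=
  ∏ i : Fin n, ∏ j : Fin n, ∏ r : Fin (k i), ∏ s : Fin (l j),
    (xvr n (emb1f n k l ⟨i, r⟩) -
        cf n (vpow (-((Dd (i.1 + 1) : ℤ) * A (i.1 + 1) (j.1 + 1)))) * xvr n (emb2f n k l ⟨j, s⟩)) /
      (xvr n (emb1f n k l ⟨i, r⟩) - xvr n (emb2f n k l ⟨j, s⟩))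

/-- the shuffle product on homogeneous components. -/
def shufMul (k l : Fin n → ℕ) (F : Fk n k) (G : Fk n l) : Fk n (k + l) :=
  (((∏ i, Nat.factorial (k i)) * (∏ i, Nat.factorial (l i)) : ℕ) : KK)⁻¹ •
    ∑ σ : ∀ i : Fin n, Equiv.Perm (Fin ((k + l) i)),
      permF n σ (emb1 n k l F * emb2 n k l G * zfac n A Dd k l)

abbrev BigS := ⨁ k : Fin n → ℕ, Fk n k

open Classical in
/-- the shuffle product, extended bilinearly to the direct sum. -/
def bstar (x y : BigS n) : BigS n :=
  DFinsupp.sum x fun k xk => DFinsupp.sum y fun l yl =>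
    DirectSum.of (fun k => Fk n k) (k + l) (shufMul n A Dd k l xk yl)

def Dpoly (k : Fin n → ℕ) : Pk n k :=
  ∏ i : Fin n, ∏ j : Fin n,
    if i < j ∧ A (i.1 + 1) (j.1 + 1) ≠ 0 then
      ∏ r : Fin (k i), ∏ s : Fin (k j), (MvPolynomial.X ⟨i, r⟩ - MvPolynomial.X (⟨j, s⟩ : Vars n k))
    else 1

def xProd (k : Fin n → ℕ) : Pk n k := ∏ u : Vars n k, MvPolynomial.X u

/-- `f` is symmetric in the variables of each color. -/
def symmQ {k : Fin n → ℕ} (f : Pk n k) : Prop :=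
  ∀ σ : ∀ i, Equiv.Perm (Fin (k i)), MvPolynomial.rename (permVf n σ) f = f

def wheelSub {k : Fin n → ℕ} (i j : Fin n) (m : ℕ) (hm : 0 < m)
    (s : Fin m → Fin (k i)) (r : Fin (k j)) : Vars n k → Pk n k := fun u =>
  if u = ⟨j, r⟩ then
    MvPolynomial.C (vpow ((Dd (i.1 + 1) : ℤ) * A (i.1 + 1) (j.1 + 1))) *
      MvPolynomial.X ⟨i, s ⟨0, hm⟩⟩
  else if h : ∃ t : Fin m, u = ⟨i, s t⟩ then
    MvPolynomial.C (vpow ((Dd (i.1 + 1) : ℤ) * (-2 * (h.choose.1 : ℤ)))) *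
      MvPolynomial.X ⟨i, s ⟨0, hm⟩⟩
  else MvPolynomial.X u

/-- the wheel conditions. -/
def wheelQ {k : Fin n → ℕ} (f : Pk n k) : Prop :=
  ∀ (i j : Fin n), i ≠ j → ∀ hA : A (i.1 + 1) (j.1 + 1) < 0,
    ∀ s : Fin (1 - A (i.1 + 1) (j.1 + 1)).toNat → Fin (k i), Function.Injective s →
      ∀ r : Fin (k j),
        MvPolynomial.aeval (wheelSub n A Dd i j _ (by omega) s r) f = 0

/-- membership in the component `S_k` of the shuffle algebra: `F = f / (denominator)` with `f`
a symmetric Laurent polynomial satisfying the wheel conditions. -/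
def inS {k : Fin n → ℕ} (F : Fk n k) : Prop :=
  ∃ (f : Pk n k) (m : ℕ), symmQ n f ∧ wheelQ n A Dd f ∧
    F * algebraMap (Pk n k) (Fk n k) (Dpoly n A k * xProd n k ^ m) = algebraMap (Pk n k) (Fk n k) f

end Shuffle

section Slots
variable {R : Type} [Fintype R] [LinearOrder R]
/-- ordered enumeration of the variable slots of color `c` determined by a Kostant partition. -/
def slots (νf : R → ℕ → ℕ) (d : R → ℕ) (c : ℕ) : List (R × ℕ × ℕ) :=
  ((Finset.univ : Finset R).sort (· ≤ ·)).flatMap fun β =>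
    (List.range (d β)).flatMap fun s => (List.range (νf β c)).map fun tt => (β, s, tt)
end Slots

section SpecD
variable (n : ℕ)
abbrev WRD := MvPolynomial (PosRootD n × ℕ) KK
abbrev FWD := FractionRing (WRD n)
abbrev WR2D := MvPolynomial ((PosRootD n × ℕ) ⊕ (PosRootD n × ℕ)) KK

def wXD (p : PosRootD n × ℕ) : FWD n := algebraMap (WRD n) (FWD n) (MvPolynomial.X p)
def cwD (a : KK) : FWD n := algebraMap KK (FWD n) a

/-- the value assigned to the variable `x^{(β,s)}_{c,t+1}` by the first-step specialization
map `φ^{(1)}` in type `D_n`. -/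
def specValD (β : PosRootD n) (s tt c : ℕ) : WR2D n :=
  if isSpecD β ∧ tt ≠ 0 then
    MvPolynomial.C (vpow ((c : ℤ) + 3 - 2 * n)) * MvPolynomial.X (Sum.inr (β, s))
  else
    (if c = n then MvPolynomial.C (vpow (2 - (n : ℤ))) * MvPolynomial.X (Sum.inl (β, s))
     else MvPolynomial.C (vpow (1 - (c : ℤ))) * MvPolynomial.X (Sum.inl (β, s)))

def phi1subD {k : Fin n → ℕ} (d : PosRootD n → ℕ) : Vars n k → WR2D n := fun u =>
  match (slots (nuD (n := n)) d (u.1.1 + 1))[(u.2.1)]? with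
  | some (β, s, tt) => specValD n β s tt (u.1.1 + 1)
  | none => 0

def BoneD (β : PosRootD n) (s : ℕ) : WR2D n :=
  if isSpecD β then
    ∏ l ∈ Finset.Icc (2 * n - riD β - rtD β) (n - 2),
      ((MvPolynomial.X (Sum.inl (β, s)) -
          MvPolynomial.C (vpow ((2 * l + 4 : ℤ) - 2 * n)) * MvPolynomial.X (Sum.inr (β, s))) *
        (MvPolynomial.X (Sum.inl (β, s)) -
          MvPolynomial.C (vpow ((2 * l : ℤ) - 2 * n)) * MvPolynomial.X (Sum.inr (β, s))))
  else 1

def BprodD (d : PosRootD n → ℕ) : WR2D n :=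
  ∏ β : PosRootD n, ∏ s ∈ Finset.range (d β), BoneD n β s

/-- second-step substitution `w'_{β,s} ↦ w_{β,s}` (type `D_n`). -/
def psi2D : WR2D n →ₐ[KK] WRD n :=
  MvPolynomial.aeval fun u => match u with
    | Sum.inl p => MvPolynomial.X p
    | Sum.inr p => MvPolynomial.X p

/-- `PhiRelD n d F P` holds iff `P = φ_d(F)` (type `D_n`). -/
def PhiRelD {k : Fin n → ℕ} (d : PosRootD n → ℕ) (F : Fk n k) (P : FWD n) : Prop :=
  ∃ (m : ℕ) (g : Pk n k) (q : WR2D n),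
    F * algebraMap (Pk n k) (Fk n k) (Dpoly n (aD n) k * xProd n k ^ m) =
        algebraMap (Pk n k) (Fk n k) g ∧
    MvPolynomial.aeval (phi1subD n d) g = BprodD n d * q ∧
    P * algebraMap (WRD n) (FWD n) (psi2D n (MvPolynomial.aeval (phi1subD n d) (xProd n k ^ m)))
      = algebraMap (WRD n) (FWD n) (psi2D n q)

def nuVecD (β : PosRootD n) : Fin n → ℕ := fun i => nuD β (i.1 + 1)

def KPmemD (k : Fin n → ℕ) (d : PosRootD n → ℕ) : Prop :=
  ∀ i : Fin n, (∑ β : PosRootD n, d β * nuD β (i.1 + 1)) = k i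

def KPltD (d' d : PosRootD n → ℕ) : Prop :=
  ∃ γ : PosRootD n, d' γ < d γ ∧ ∀ β : PosRootD n, β < γ → d' β = d β
end SpecD

/-- the `i`-th coordinate vector `1_i ∈ ℕ^n`. -/
def unitVec {n : ℕ} (i : Fin n) : Fin n → ℕ := fun j => if j = i then 1 else 0

/-- the Kostant partition `δ_β` consisting of the single root `β`. -/
def dOne {R : Type} [DecidableEq R] (β : R) : R → ℕ := fun γ => if γ = β then 1 else 0

section SpecializationHelpers
open MvPolynomial (X C rename aeval)

section ShuffleLemmas
variable {n : ℕ}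

lemma liftHom_algebraMap {k m : Fin n → ℕ} (f : Vars n k → Vars n m) (hf : Function.Injective f)
    (p : Pk n k) :
    liftHom n f hf (algebraMap (Pk n k) (Fk n k) p) =
      algebraMap (Pk n m) (Fk n m) (MvPolynomial.rename f p) := by
  unfold liftHom
  rw [IsFractionRing.lift_algebraMap]
  rfl

lemma liftHom_liftHom {k l m : Fin n → ℕ} (f : Vars n k → Vars n l) (hf : Function.Injective f)
    (g : Vars n l → Vars n m) (hg : Function.Injective g) (x : Fk n k) :
    liftHom n g hg (liftHom n f hf x) = liftHom n (g ∘ f) (hg.comp hf) x := by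
  have h : (liftHom n g hg).comp (liftHom n f hf) = liftHom n (g ∘ f) (hg.comp hf) := by
    apply IsLocalization.ringHom_ext (nonZeroDivisors (Pk n k))
    refine RingHom.ext fun p => ?_
    simp only [RingHom.comp_apply, liftHom_algebraMap, MvPolynomial.rename_rename]
  exact congrArg (fun φ => φ x) h

lemma liftHom_congr {k m : Fin n → ℕ} {f g : Vars n k → Vars n m} (hf : Function.Injective f)
    (hg : Function.Injective g) (h : ∀ u, f u = g u) (x : Fk n k) :
    liftHom n f hf x = liftHom n g hg x := by
  obtain rfl : f = g := funext h
  rfl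

lemma liftHom_id {k : Fin n → ℕ} (hf : Function.Injective (id : Vars n k → Vars n k))
    (x : Fk n k) : liftHom n id hf x = x := by
  have h : liftHom n id hf = RingHom.id (Fk n k) := by
    apply IsLocalization.ringHom_ext (nonZeroDivisors (Pk n k))
    refine RingHom.ext fun p => ?_
    simp only [RingHom.comp_apply, liftHom_algebraMap, MvPolynomial.rename_id, RingHom.id_apply,
      AlgHom.id_apply]
  exact congrArg (fun φ => φ x) h

lemma cf_eq {k : Fin n → ℕ} (a : KK) :
    (cf n a : Fk n k) = algebraMap (Pk n k) (Fk n k) (MvPolynomial.C a) := by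
  unfold cf
  rw [IsScalarTower.algebraMap_apply KK (Pk n k) (Fk n k)]
  rfl

@[simp] lemma liftHom_xvr {k m : Fin n → ℕ} (f : Vars n k → Vars n m) (hf : Function.Injective f)
    (u : Vars n k) : liftHom n f hf (xvr n u) = xvr n (f u) := by
  simp [xvr, liftHom_algebraMap]

@[simp] lemma liftHom_cf {k m : Fin n → ℕ} (f : Vars n k → Vars n m) (hf : Function.Injective f)
    (a : KK) : liftHom n f hf (cf n a) = cf n a := by
  simp [cf_eq, liftHom_algebraMap]

lemma smul_eq_cf {k : Fin n → ℕ} (a : KK) (x : Fk n k) : a • x = cf n a * x := by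
  rw [Algebra.smul_def]; rfl

lemma permF_mul {m : Fin n → ℕ} (σ τ : ∀ i, Equiv.Perm (Fin (m i))) (x : Fk n m) :
    permF n σ (permF n τ x) = permF n (fun i => σ i * τ i) x := by
  unfold permF
  rw [liftHom_liftHom]
  exact liftHom_congr _ _ (fun u => rfl) x

/-- invariance of a rational function under permuting the variables of each color. -/
def SymF {m : Fin n → ℕ} (F : Fk n m) : Prop :=
  ∀ σ : ∀ i, Equiv.Perm (Fin (m i)), permF n σ F = F

lemma sum_permF_mul_right {m : Fin n → ℕ} (τ : ∀ i, Equiv.Perm (Fin (m i))) (x : Fk n m) :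
    ∑ σ : ∀ i, Equiv.Perm (Fin (m i)), permF n σ (permF n τ x) =
      ∑ σ : ∀ i, Equiv.Perm (Fin (m i)), permF n σ x := by
  simp only [permF_mul]
  exact Fintype.sum_equiv (Equiv.mulRight τ) _ _ (fun σ => rfl)

lemma symF_sum {m : Fin n → ℕ} (a : KK) (x : Fk n m) :
    SymF (a • ∑ σ : ∀ i, Equiv.Perm (Fin (m i)), permF n σ x) := by
  intro τ
  rw [smul_eq_cf, map_mul, map_sum]
  congr 1
  · simp [permF]
  · simp only [permF_mul]
    exact Fintype.sum_equiv (Equiv.mulLeft τ) _ _ (fun σ => rfl)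

/-- the color-preserving bijection of the variables induced by permutations. -/
def permVEquiv {m : Fin n → ℕ} (σ : ∀ i, Equiv.Perm (Fin (m i))) : Vars n m ≃ Vars n m :=
  Equiv.sigmaCongrRight σ

/-- the inclusion of variables preserving the indices. -/
def embA (k : Fin n → ℕ) (l : Fin n) : Vars n k → Vars n (k + unitVec l) :=
  emb1f n k (unitVec l)

lemma embA_inj (k : Fin n → ℕ) (l : Fin n) : Function.Injective (embA k l) :=
  emb1f_inj n k (unitVec l)

/-- the variable of color `l` added last. -/
def newV (k : Fin n → ℕ) (l : Fin n) : Vars n (k + unitVec l) :=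
  ⟨l, ⟨k l, by simp [unitVec]⟩⟩

instance (l : Fin n) : Unique (Vars n (unitVec l)) where
  default := ⟨l, ⟨0, by simp [unitVec]⟩⟩
  uniq := by
    rintro ⟨i, r⟩
    have hr := r.2
    have hi : i = l := by
      by_contra h
      simp [unitVec, h] at hr
    subst hi
    have : r.1 < 1 := by simpa [unitVec] using hr
    congr 1
    exact Fin.ext (by simp; omega)

lemma default_vars (l : Fin n) :
    (default : Vars n (unitVec l)) = ⟨l, ⟨0, by simp [unitVec]⟩⟩ := rfl

lemma prod_vars {M : Type*} [CommMonoid M] {m : Fin n → ℕ} (f : Vars n m → M) :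
    ∏ i : Fin n, ∏ r : Fin (m i), f ⟨i, r⟩ = ∏ u : Vars n m, f u :=
  (Fintype.prod_sigma f).symm

lemma prod_vars₂ {M : Type*} [CommMonoid M] {k m : Fin n → ℕ} (f : Vars n k → Vars n m → M) :
    ∏ i : Fin n, ∏ j : Fin n, ∏ r : Fin (k i), ∏ s : Fin (m j), f ⟨i, r⟩ ⟨j, s⟩ =
      ∏ u : Vars n k, ∏ w : Vars n m, f u w := by
  simp only [← prod_vars]
  refine Finset.prod_congr rfl fun i _ => ?_
  rw [Finset.prod_comm]

/-- the variables after adding one variable of color `l`. -/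
lemma embA_ne_newV (k : Fin n → ℕ) (l : Fin n) (u : Vars n k) : embA k l u ≠ newV k l := by
  obtain ⟨i, r⟩ := u
  intro h
  simp only [embA, emb1f, newV, Sigma.mk.inj_iff] at h
  obtain ⟨rfl, h2⟩ := h
  rw [heq_iff_eq, Fin.mk.injEq] at h2
  exact absurd r.2 (by omega)

lemma eq_embA_or_newV (k : Fin n → ℕ) (l : Fin n) (u : Vars n (k + unitVec l)) :
    (∃ w, embA k l w = u) ∨ u = newV k l := by
  obtain ⟨i, r, hr⟩ := u
  by_cases h : r < k i
  · exact Or.inl ⟨⟨i, ⟨r, h⟩⟩, rfl⟩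
  · right
    have hr' : r < k i + unitVec l i := hr
    have hi : i = l := by
      by_contra hi
      simp [unitVec, hi] at hr'
      omega
    subst hi
    simp [unitVec] at hr'
    simp only [newV]
    congr 2
    omega

/-- `Vars (k + 1_l)` is `Vars k` with one new variable. -/
def optEquiv (k : Fin n → ℕ) (l : Fin n) : Option (Vars n k) ≃ Vars n (k + unitVec l) :=
  Equiv.ofBijective (fun o => o.elim (newV k l) (embA k l)) (by
    constructor
    · rintro (_ | a) (_ | b) h
      · rfl
      · exact absurd h.symm (embA_ne_newV k l b)
      · exact absurd h (embA_ne_newV k l a)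
      · exact congrArg some (embA_inj k l h)
    · intro u
      rcases eq_embA_or_newV k l u with ⟨w, rfl⟩ | rfl
      · exact ⟨some w, rfl⟩
      · exact ⟨none, rfl⟩)

lemma prod_vars_add {M : Type*} [CommMonoid M] (k : Fin n → ℕ) (l : Fin n)
    (f : Vars n (k + unitVec l) → M) :
    ∏ u, f u = f (newV k l) * ∏ u : Vars n k, f (embA k l u) := by
  rw [← Equiv.prod_comp (optEquiv k l), Fintype.prod_option]
  rfl

end ShuffleLemmas

section ShuffleProduct
variable {n : ℕ} (A : ℕ → ℕ → ℤ) (Dd : ℕ → ℕ)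

/-- `v^{-d_i a_{ij}}` for colors `i, j`. -/
def zc (i j : Fin n) : KK := vpow (-((Dd (i.1 + 1) : ℤ) * A (i.1 + 1) (j.1 + 1)))

/-- the factor `ζ_{ij}(x/y)`. -/
def zetaF {m : Fin n → ℕ} (i j : Fin n) (x y : Fk n m) : Fk n m :=
  (x - cf n (zc A Dd i j) * y) / (x - y)

lemma zfac_eq (k l : Fin n → ℕ) :
    zfac n A Dd k l = ∏ u : Vars n k, ∏ w : Vars n l,
      zetaF A Dd u.1 w.1 (xvr n (emb1f n k l u)) (xvr n (emb2f n k l w)) := by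
  rw [← prod_vars₂]
  rfl

/-- the number of permutations used to normalize the product with a degree-one element. -/
def factProd (k : Fin n → ℕ) : ℕ := ∏ i, Nat.factorial (k i)

lemma factProd_unitVec (l : Fin n) : factProd (unitVec l) = 1 := by
  unfold factProd
  refine Finset.prod_eq_one fun i _ => ?_
  unfold unitVec
  split_ifs <;> rfl

lemma factProd_add (k : Fin n → ℕ) (l : Fin n) :
    factProd (k + unitVec l) = factProd k * (k l + 1) := by
  unfold factProd
  have h : ∀ i, Nat.factorial ((k + unitVec l) i) =
      Nat.factorial (k i) * (if i = l then k l + 1 else 1) := by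
    intro i
    simp only [Pi.add_apply, unitVec]
    split_ifs with h
    · subst h; rw [Nat.factorial_succ, mul_comm]
    · simp
  simp only [h, Finset.prod_mul_distrib, Finset.prod_ite_eq',
    Finset.mem_univ, if_true]

lemma card_perms (k : Fin n → ℕ) :
    Fintype.card (∀ i, Equiv.Perm (Fin (k i))) = factProd k := by
  simp [Fintype.card_pi, Fintype.card_perm, factProd]

lemma factProd_ne_zero (k : Fin n → ℕ) : (factProd k : KK) ≠ 0 := by
  rw [Nat.cast_ne_zero]
  exact Finset.prod_ne_zero_iff.mpr fun i _ => Nat.factorial_ne_zero _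

/-- the unsymmetrized product of `F` with a power of the new variable. -/
def rawR (k : Fin n → ℕ) (l : Fin n) (F : Fk n k) (r : ℤ) : Fk n (k + unitVec l) :=
  liftHom n (embA k l) (embA_inj k l) F * xvr n (newV k l) ^ r *
    ∏ u : Vars n k, zetaF A Dd u.1 l (xvr n (embA k l u)) (xvr n (newV k l))

/-- the unsymmetrized product of a power of the new variable with `F`. -/
def rawL (k : Fin n → ℕ) (l : Fin n) (F : Fk n k) (r : ℤ) : Fk n (k + unitVec l) :=
  liftHom n (embA k l) (embA_inj k l) F * xvr n (newV k l) ^ r *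
    ∏ u : Vars n k, zetaF A Dd l u.1 (xvr n (newV k l)) (xvr n (embA k l u))

/-- the generator `x_{l,1}^r` of the shuffle algebra. -/
def genS (l : Fin n) (r : ℤ) : Fk n (unitVec l) :=
  xvr n (⟨l, ⟨0, by simp [unitVec]⟩⟩ : Vars n (unitVec l)) ^ r

lemma shufMul_genS (k : Fin n → ℕ) (l : Fin n) (F : Fk n k) (r : ℤ) :
    shufMul n A Dd k (unitVec l) F (genS l r) =
      (factProd k : KK)⁻¹ • ∑ σ : ∀ i, Equiv.Perm (Fin ((k + unitVec l) i)),
        permF n σ (rawR A Dd k l F r) := by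
  unfold shufMul
  have h1 : ((∏ i, Nat.factorial (k i)) * ∏ i, Nat.factorial (unitVec l i)) = factProd k := by
    change factProd k * factProd (unitVec l) = _
    rw [factProd_unitVec, mul_one]
  rw [h1]
  congr 1
  refine Finset.sum_congr rfl fun σ _ => ?_
  congr 1
  unfold rawR
  rw [zfac_eq]
  simp only [Fintype.prod_unique]
  congr 1
  congr 1
  unfold genS emb2
  rw [map_zpow₀, liftHom_xvr]
  rfl

/-- the transposition of the first and the last variable of color `l`. -/
def swapP (k : Fin n → ℕ) (l : Fin n) : ∀ i, Equiv.Perm (Fin ((k + unitVec l) i)) := fun i =>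
  if h : i = l then
    Equiv.swap ⟨0, by subst h; simp [unitVec]⟩ ⟨k i, by subst h; simp [unitVec]⟩
  else 1

/-- transport of variables along an equality of degrees. -/
def castV {k m : Fin n → ℕ} (h : k = m) : Vars n k → Vars n m :=
  fun u => ⟨u.1, ⟨u.2.1, h ▸ u.2.2⟩⟩

lemma castV_inj {k m : Fin n → ℕ} (h : k = m) : Function.Injective (castV h) := by
  subst h
  exact fun u w h => h

lemma shufMul_genS_left_aux (k : Fin n → ℕ) (l : Fin n) (F : Fk n k) (r : ℤ) :
    shufMul n A Dd (unitVec l) k (genS l r) F =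
      ((factProd k : KK)⁻¹ • ∑ σ : ∀ i, Equiv.Perm (Fin ((unitVec l + k) i)),
        permF n σ (liftHom n (emb2f n (unitVec l) k) (emb2f_inj n _ _) F *
          xvr n (emb1f n (unitVec l) k default) ^ r *
          ∏ u : Vars n k, zetaF A Dd l u.1 (xvr n (emb1f n (unitVec l) k default))
            (xvr n (emb2f n (unitVec l) k u)))) := by
  unfold shufMul
  have h1 : ((∏ i, Nat.factorial (unitVec l i)) * ∏ i, Nat.factorial (k i)) = factProd k := by
    change factProd (unitVec l) * factProd k = _
    rw [factProd_unitVec, one_mul]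
  rw [h1]
  congr 1
  refine Finset.sum_congr rfl fun σ _ => ?_
  congr 1
  rw [zfac_eq, Fintype.prod_unique, mul_comm (emb1 n _ _ _)]
  congr 1
  congr 1
  unfold genS emb1
  rw [map_zpow₀, liftHom_xvr]
  rfl

lemma of_sum_permF_cast {k m : Fin n → ℕ} (h : k = m) (a : KK) (x : Fk n k) :
    DirectSum.of (fun k => Fk n k) k
        (a • ∑ σ : ∀ i, Equiv.Perm (Fin (k i)), permF n σ x) =
      DirectSum.of (fun k => Fk n k) m
        (a • ∑ σ : ∀ i, Equiv.Perm (Fin (m i)),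
          permF n σ (liftHom n (castV h) (castV_inj h) x)) := by
  subst h
  have h1 : liftHom n (castV rfl) (castV_inj rfl) x = x :=
    (liftHom_congr _ Function.injective_id (fun u => rfl) x).trans (liftHom_id _ x)
  rw [h1]

lemma permVf_swapP_self (k : Fin n → ℕ) (l : Fin n) (a : Fin ((k + unitVec l) l)) :
    permVf n (swapP k l) ⟨l, a⟩ =
      ⟨l, Equiv.swap ⟨0, by simp [unitVec]⟩ ⟨k l, by simp [unitVec]⟩ a⟩ := by
  unfold permVf swapP
  simp only [dif_pos]

lemma permVf_swapP_of_ne (k : Fin n → ℕ) (l : Fin n) (u : Vars n (k + unitVec l))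
    (h : u.1 ≠ l) : permVf n (swapP k l) u = u := by
  unfold permVf swapP
  rw [dif_neg h]
  rfl

lemma permVf_swapP_newV (k : Fin n → ℕ) (l : Fin n) :
    permVf n (swapP k l) (newV k l) = ⟨l, ⟨0, by simp [unitVec]⟩⟩ := by
  unfold newV
  rw [permVf_swapP_self, Equiv.swap_apply_right]

lemma permVf_swapP_zero (k : Fin n → ℕ) (l : Fin n) (h : 0 < (k + unitVec l) l) :
    permVf n (swapP k l) ⟨l, ⟨0, h⟩⟩ = newV k l := by
  rw [permVf_swapP_self, Equiv.swap_apply_left]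
  rfl

lemma swapP_castV_default (k : Fin n → ℕ) (l : Fin n) :
    permVf n (swapP k l)
      (castV (add_comm _ _) (emb1f n (unitVec l) k default)) = newV k l :=
  permVf_swapP_zero k l _

lemma swapP_castV_emb2f (k : Fin n → ℕ) (l : Fin n) (hk : k l ≤ 1) (u : Vars n k) :
    permVf n (swapP k l) (castV (add_comm _ _) (emb2f n (unitVec l) k u)) = embA k l u := by
  obtain ⟨i, a⟩ := u
  have ha : a.1 < k i := a.2
  by_cases hi : i = l
  · subst hi
    have hu : unitVec i i = 1 := by simp [unitVec]
    have h1 : castV (add_comm _ _) (emb2f n (unitVec i) k ⟨i, a⟩) = newV k i := by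
      unfold castV emb2f newV
      congr 2
      change unitVec i i + a.1 = k i
      omega
    rw [h1, permVf_swapP_newV]
    unfold embA emb1f
    congr 2
    change 0 = a.1
    omega
  · rw [permVf_swapP_of_ne _ _ _ hi]
    unfold castV emb2f embA emb1f
    congr 2
    change unitVec l i + a.1 = a.1
    simp [unitVec, hi]

lemma permVf_swapP_swapP (k : Fin n → ℕ) (l : Fin n) (u : Vars n (k + unitVec l)) :
    permVf n (swapP k l) (permVf n (swapP k l) u) = u := by
  by_cases h : u.1 = l
  · obtain ⟨i, a⟩ := u
    obtain rfl : i = l := h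
    rw [permVf_swapP_self, permVf_swapP_self, Equiv.swap_apply_self]
  · rw [permVf_swapP_of_ne _ _ u h, permVf_swapP_of_ne _ _ u h]

lemma liftHom_zetaF {k m : Fin n → ℕ} (f : Vars n k → Vars n m) (hf : Function.Injective f)
    (i j : Fin n) (x y : Fk n k) :
    liftHom n f hf (zetaF A Dd i j x y) =
      zetaF A Dd i j (liftHom n f hf x) (liftHom n f hf y) := by
  simp only [zetaF, map_div₀, map_sub, map_mul, liftHom_cf]

lemma castV_default_eq (k : Fin n → ℕ) (l : Fin n) :
    castV (add_comm (unitVec l) k) (emb1f n (unitVec l) k default) =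
      permVf n (swapP k l) (newV k l) := by
  rw [← swapP_castV_default, permVf_swapP_swapP]

lemma castV_emb2f_eq (k : Fin n → ℕ) (l : Fin n) (hk : k l ≤ 1) (u : Vars n k) :
    castV (add_comm (unitVec l) k) (emb2f n (unitVec l) k u) =
      permVf n (swapP k l) (embA k l u) := by
  rw [← swapP_castV_emb2f k l hk, permVf_swapP_swapP]

lemma liftHom_castV_rawL (k : Fin n → ℕ) (l : Fin n) (hk : k l ≤ 1) (F : Fk n k) (r : ℤ) :
    liftHom n (castV (add_comm (unitVec l) k)) (castV_inj _)
      (liftHom n (emb2f n (unitVec l) k) (emb2f_inj n _ _) F *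
          xvr n (emb1f n (unitVec l) k default) ^ r *
          ∏ u : Vars n k, zetaF A Dd l u.1 (xvr n (emb1f n (unitVec l) k default))
            (xvr n (emb2f n (unitVec l) k u))) = permF n (swapP k l) (rawL A Dd k l F r) := by
  unfold rawL permF
  rw [map_mul, map_mul, map_mul, map_mul, map_prod, map_prod, map_zpow₀, map_zpow₀,
    liftHom_xvr, liftHom_xvr, castV_default_eq, liftHom_liftHom, liftHom_liftHom]
  refine congrArg₂ (· * ·) (congrArg₂ (· * ·) ?_ rfl) ?_
  · exact liftHom_congr _ _ (castV_emb2f_eq k l hk) F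
  · refine Finset.prod_congr rfl fun u _ => ?_
    rw [liftHom_zetaF, liftHom_zetaF, liftHom_xvr, liftHom_xvr, liftHom_xvr, liftHom_xvr,
      castV_default_eq, castV_emb2f_eq k l hk]

lemma of_shufMul_genS_left (k : Fin n → ℕ) (l : Fin n) (hk : k l ≤ 1) (F : Fk n k) (r : ℤ) :
    DirectSum.of (fun k => Fk n k) (unitVec l + k) (shufMul n A Dd (unitVec l) k (genS l r) F) =
      DirectSum.of (fun k => Fk n k) (k + unitVec l)
      ((factProd k : KK)⁻¹ • ∑ σ : ∀ i, Equiv.Perm (Fin ((k + unitVec l) i)),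
        permF n σ (rawL A Dd k l F r)) := by
  rw [shufMul_genS_left_aux, of_sum_permF_cast (add_comm (unitVec l) k),
    liftHom_castV_rawL A Dd k l hk, sum_permF_mul_right]

lemma bstar_of (k l : Fin n → ℕ) (F : Fk n k) (G : Fk n l) :
    bstar n A Dd (DirectSum.of (fun k => Fk n k) k F) (DirectSum.of (fun k => Fk n k) l G) =
      DirectSum.of (fun k => Fk n k) (k + l) (shufMul n A Dd k l F G) := by
  classical
  have h0 : ∀ l (G : Fk n l), shufMul n A Dd k l 0 G = 0 := fun l G => by simp [shufMul]
  have h1 : shufMul n A Dd k l F 0 = 0 := by simp [shufMul]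
  unfold bstar
  refine (DFinsupp.sum_single_index ?_).trans ((DFinsupp.sum_single_index ?_).trans ?_)
  · simp [DFinsupp.sum, h0]
  · simp [h1]
  · congr!

end ShuffleProduct

section Symmetrization
variable {n : ℕ} (A : ℕ → ℕ → ℤ) (Dd : ℕ → ℕ)

/-- the unsymmetrized bracket of `F` with the generator `x_{l,1}^r`. -/
def rawB (k : Fin n → ℕ) (l : Fin n) (F : Fk n k) (r : ℤ) (a : KK) : Fk n (k + unitVec l) :=
  rawR A Dd k l F r - cf n a * rawL A Dd k l F r

/-- the bracket of `F` with the generator `x_{l,1}^r` in the shuffle algebra. -/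
def braS (k : Fin n → ℕ) (l : Fin n) (F : Fk n k) (r : ℤ) (a : KK) : Fk n (k + unitVec l) :=
  (factProd k : KK)⁻¹ • ∑ σ : ∀ i, Equiv.Perm (Fin ((k + unitVec l) i)),
        permF n σ (rawB A Dd k l F r a)

lemma symF_braS (k : Fin n → ℕ) (l : Fin n) (F : Fk n k) (r : ℤ) (a : KK) :
    SymF (braS A Dd k l F r a) := symF_sum _ _

lemma permF_cf {m : Fin n → ℕ} (σ : ∀ i, Equiv.Perm (Fin (m i))) (a : KK) :
    permF n σ (cf n a) = cf n a := by simp [permF]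

lemma bracket_of (Ψ : UA n A Dd →ₗ[KK] BigS n)
    (hmul : ∀ a b, Ψ (a * b) = bstar n A Dd (Ψ a) (Ψ b))
    (k : Fin n → ℕ) (l : Fin n) (hk : k l ≤ 1) (F : Fk n k) (r : ℤ) (a : KK) (x g : UA n A Dd)
    (hx : Ψ x = DirectSum.of (fun k => Fk n k) k F)
    (hg : Ψ g = DirectSum.of (fun k => Fk n k) (unitVec l) (genS l r)) :
    Ψ (x * g - a • (g * x)) = DirectSum.of (fun k => Fk n k) (k + unitVec l)
      (braS A Dd k l F r a) := by
  have hs : ∀ (m : Fin n → ℕ) (y : Fk n m), a • DirectSum.of (fun k => Fk n k) m y =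
      DirectSum.of (fun k => Fk n k) m (cf n a * y) := by
    intro m y
    rw [← smul_eq_cf]
    exact (DirectSum.lof KK _ _ m).map_smul a y |>.symm
  rw [map_sub, map_smul, hmul, hmul, hx, hg, bstar_of, bstar_of,
    of_shufMul_genS_left A Dd k l hk, shufMul_genS, hs, ← map_sub]
  refine congrArg _ ?_
  unfold braS rawB
  simp only [map_sub, map_mul, permF_cf, Finset.sum_sub_distrib, ← Finset.mul_sum, smul_eq_cf]
  ring

lemma exists_restrict (k : Fin n → ℕ) (l : Fin n)
    (σ : ∀ i, Equiv.Perm (Fin ((k + unitVec l) i))) (hσ : σ l = 1) :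
    ∃ σ' : ∀ i, Equiv.Perm (Fin (k i)),
      ∀ u, permVf n σ (embA k l u) = embA k l (permVf n σ' u) := by
  have hc : ∀ c, c ≠ l → (k + unitVec l) c = k c := fun c hc => by simp [unitVec, hc]
  refine ⟨fun c => if h : c = l then 1 else (finCongr (hc c h)).permCongr (σ c), ?_⟩
  rintro ⟨i, a⟩
  by_cases hi : i = l
  · subst hi
    unfold permVf embA emb1f
    simp only [dif_pos, hσ]
    rfl
  · unfold permVf embA emb1f
    simp only [dif_neg hi]
    rfl

lemma permF_rawB (k : Fin n → ℕ) (l : Fin n) (F : Fk n k) (hF : SymF F) (r : ℤ) (a : KK)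
    (σ : ∀ i, Equiv.Perm (Fin ((k + unitVec l) i))) (hσ : σ l = 1) :
    permF n σ (rawB A Dd k l F r a) = rawB A Dd k l F r a := by
  obtain ⟨σ', h⟩ := exists_restrict k l σ hσ
  have hz : permVf n σ (newV k l) = newV k l := by
    unfold permVf newV
    simp only [hσ]
    rfl
  have hFF : permF n σ (liftHom n (embA k l) (embA_inj k l) F) =
      liftHom n (embA k l) (embA_inj k l) F := by
    conv_rhs => rw [← hF σ']
    unfold permF
    rw [liftHom_liftHom, liftHom_liftHom]
    exact liftHom_congr _ _ h F
  have hzeta : ∀ (i j : Fin n) (x y : Fk n (k + unitVec l)), permF n σ (zetaF A Dd i j x y) =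
      zetaF A Dd i j (permF n σ x) (permF n σ y) := fun i j x y => liftHom_zetaF A Dd _ _ i j x y
  have hxv : ∀ u : Vars n (k + unitVec l), permF n σ (xvr n u) = xvr n (permVf n σ u) :=
    fun u => liftHom_xvr _ _ u
  have h1 : ∏ u : Vars n k, permF n σ (zetaF A Dd u.1 l (xvr n (embA k l u)) (xvr n (newV k l))) =
      ∏ u : Vars n k, zetaF A Dd u.1 l (xvr n (embA k l u)) (xvr n (newV k l)) := by
    refine Eq.trans ?_ (Equiv.prod_comp (permVEquiv σ') _)
    refine Finset.prod_congr rfl fun u _ => ?_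
    rw [hzeta, hxv, hxv, hz, h]
    rfl
  have h2 : ∏ u : Vars n k, permF n σ (zetaF A Dd l u.1 (xvr n (newV k l)) (xvr n (embA k l u))) =
      ∏ u : Vars n k, zetaF A Dd l u.1 (xvr n (newV k l)) (xvr n (embA k l u)) := by
    refine Eq.trans ?_ (Equiv.prod_comp (permVEquiv σ') _)
    refine Finset.prod_congr rfl fun u _ => ?_
    rw [hzeta, hxv, hxv, hz, h]
    rfl
  unfold rawB rawR rawL
  rw [map_sub, map_mul, map_mul, map_mul, map_mul, map_mul, map_prod, map_prod, map_zpow₀, hFF,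
    hxv, hz, h1, h2, permF_cf]

lemma permF_eq_of_apply_eq (k : Fin n → ℕ) (l : Fin n) (F : Fk n k) (hF : SymF F) (r : ℤ) (a : KK)
    (σ τ : ∀ i, Equiv.Perm (Fin ((k + unitVec l) i))) (h : σ l = τ l) :
    permF n σ (rawB A Dd k l F r a) = permF n τ (rawB A Dd k l F r a) := by
  have h1 : σ = fun i => τ i * ((τ i)⁻¹ * σ i) := by
    funext i; simp
  rw [h1, ← permF_mul, permF_rawB A Dd k l F hF r a _ (by simp [h])]

lemma cast_factProd_smul {m : Fin n → ℕ} (k : Fin n → ℕ) (x : Fk n m) :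
    (factProd k : KK)⁻¹ • (factProd k • x) = x := by
  rw [← Nat.cast_smul_eq_nsmul KK, inv_smul_smul₀ (factProd_ne_zero k)]

lemma braS_of_zero (k : Fin n → ℕ) (l : Fin n) (hk : k l = 0) (F : Fk n k) (hF : SymF F) (r : ℤ)
    (a : KK) : braS A Dd k l F r a = rawB A Dd k l F r a := by
  have hs : Subsingleton (Fin ((k + unitVec l) l)) := by
    rw [Fin.subsingleton_iff_le_one]
    simp [unitVec, hk]
  have h : ∀ σ ∈ (Finset.univ : Finset (∀ i, Equiv.Perm (Fin ((k + unitVec l) i)))),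
      permF n σ (rawB A Dd k l F r a) = rawB A Dd k l F r a := fun σ _ =>
    permF_rawB A Dd k l F hF r a σ (Subsingleton.elim _ _)
  unfold braS
  rw [Finset.sum_congr rfl h, Finset.sum_const, Finset.card_univ, card_perms, factProd_add, hk,
    zero_add, mul_one, cast_factProd_smul]

lemma perm_fin_two {N : ℕ} (hN : N = 2) (σ : Equiv.Perm (Fin N)) :
    σ = 1 ∨ σ = Equiv.swap ⟨0, by omega⟩ ⟨1, by omega⟩ := by
  subst hN
  revert σ
  decide

lemma braS_of_one (k : Fin n → ℕ) (l : Fin n) (hk : k l = 1) (F : Fk n k) (hF : SymF F) (r : ℤ)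
    (a : KK) : braS A Dd k l F r a =
      rawB A Dd k l F r a + permF n (swapP k l) (rawB A Dd k l F r a) := by
  set X := rawB A Dd k l F r a with hX
  have hsw : swapP k l l = Equiv.swap ⟨0, by simp [unitVec]⟩ ⟨1, by simp [unitVec, hk]⟩ := by
    unfold swapP
    simp only [dif_pos, hk]
  have h : ∀ σ ∈ (Finset.univ : Finset (∀ i, Equiv.Perm (Fin ((k + unitVec l) i)))),
      permF n σ X + permF n σ (permF n (swapP k l) X) = X + permF n (swapP k l) X := by
    intro σ _
    rcases perm_fin_two (by simp [unitVec, hk]) (σ l) with h | h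
    · rw [hX, permF_rawB A Dd k l F hF r a σ h, permF_mul,
        permF_eq_of_apply_eq A Dd k l F hF r a _ (swapP k l) (by simp [h])]
    · have h1 : σ l * swapP k l l = 1 := by rw [h, hsw, Equiv.swap_mul_self]
      rw [← hsw] at h
      have h2 := permF_rawB A Dd k l F hF r a (fun i => σ i * swapP k l i) h1
      rw [hX, permF_eq_of_apply_eq A Dd k l F hF r a σ (swapP k l) h, permF_mul, h2]
      exact add_comm _ _
  have h2 : ∑ σ : ∀ i, Equiv.Perm (Fin ((k + unitVec l) i)), permF n σ X =
      factProd k • (X + permF n (swapP k l) X) := by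
    have h3 := Finset.sum_congr rfl h
    rw [Finset.sum_add_distrib, sum_permF_mul_right, Finset.sum_const, Finset.card_univ,
      card_perms, factProd_add, hk, ← two_nsmul, mul_comm, mul_smul] at h3
    exact (smul_right_injective _ (two_ne_zero (α := ℕ))) h3
  unfold braS
  rw [← hX, h2, cast_factProd_smul]

end Symmetrization

section Numerators
variable {n : ℕ}

lemma aD_symm (n i j : ℕ) : aD n i j = aD n j i := by
  unfold aD
  split_ifs <;> first | rfl | omega

lemma aD_self (n i : ℕ) : aD n i i = 2 := by simp [aD]

/-- `v^{-a_{ij}}` in type `D_n`. -/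
abbrev zD (i j : Fin n) : KK := vpow (-aD n (i.1 + 1) (j.1 + 1))

lemma zc_eq (i j : Fin n) : zc (aD n) (dD n) i j = zD i j := by
  simp [zc, dD]

lemma zc_eq' (i j : Fin n) : zc (aD n) (dD n) i j = zD j i := by
  rw [zc_eq, zD, aD_symm]

/-- the polynomial `x_u - x_{new}`, or `1` for colors which are not connected. -/
def facE (k : Fin n → ℕ) (l : Fin n) (u : Vars n k) : Pk n (k + unitVec l) :=
  if aD n (u.1.1 + 1) (l.1 + 1) = 0 then 1 else X (embA k l u) - X (newV k l)

/-- the numerator of `ζ(x_u/x_{new})` over `facE`. -/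
def facR (k : Fin n → ℕ) (l : Fin n) (u : Vars n k) : Pk n (k + unitVec l) :=
  if aD n (u.1.1 + 1) (l.1 + 1) = 0 then 1
  else X (embA k l u) - C (zD u.1 l) * X (newV k l)

/-- the numerator of `ζ(x_{new}/x_u)` over `facE`. -/
def facL (k : Fin n → ℕ) (l : Fin n) (u : Vars n k) : Pk n (k + unitVec l) :=
  if aD n (u.1.1 + 1) (l.1 + 1) = 0 then 1
  else C (zD u.1 l) * X (embA k l u) - X (newV k l)

lemma X_sub_X_ne_zero {m : Fin n → ℕ} {u w : Vars n m} (h : u ≠ w) :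
    (X u - X w : Pk n m) ≠ 0 := by
  rw [sub_ne_zero]
  exact fun e => h (MvPolynomial.X_injective e)

lemma xvr_sub_ne_zero {m : Fin n → ℕ} {u w : Vars n m} (h : u ≠ w) :
    (xvr n u - xvr n w : Fk n m) ≠ 0 := by
  unfold xvr
  rw [← map_sub]
  exact (map_ne_zero_iff _ (IsFractionRing.injective (Pk n m) (Fk n m))).mpr (X_sub_X_ne_zero h)

lemma zetaF_mul_facE_right (k : Fin n → ℕ) (l : Fin n) (u : Vars n k) :
    zetaF (aD n) (dD n) u.1 l (xvr n (embA k l u)) (xvr n (newV k l)) *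
      algebraMap _ (Fk n (k + unitVec l)) (facE k l u) = algebraMap _ _ (facR k l u) := by
  have h := xvr_sub_ne_zero (embA_ne_newV k l u)
  unfold zetaF facE facR
  rw [zc_eq]
  split_ifs with h0
  · have h1 : (cf n (zD u.1 l) : Fk n (k + unitVec l)) = 1 := by
      simp [zD, h0, vpow, cf]
    rw [h1, one_mul, div_self h, map_one, one_mul]
  · rw [map_sub, map_sub, map_mul, ← cf_eq]
    exact div_mul_cancel₀ _ h

lemma zetaF_mul_facE_left (k : Fin n → ℕ) (l : Fin n) (u : Vars n k) :
    zetaF (aD n) (dD n) l u.1 (xvr n (newV k l)) (xvr n (embA k l u)) *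
      algebraMap _ (Fk n (k + unitVec l)) (facE k l u) = algebraMap _ _ (facL k l u) := by
  have h := xvr_sub_ne_zero (embA_ne_newV k l u)
  unfold zetaF facE facL
  rw [zc_eq']
  have h' : xvr n (newV k l) - xvr n (embA k l u) ≠ 0 := by
    rw [← neg_sub]; exact neg_ne_zero.mpr h
  split_ifs with h0
  · have h1 : (cf n (zD u.1 l) : Fk n (k + unitVec l)) = 1 := by
      simp [zD, h0, vpow, cf]
    rw [h1, one_mul, div_self h', map_one, one_mul]
  · rw [map_sub, map_sub, map_mul, ← cf_eq]
    change _ / _ * (xvr n (embA k l u) - xvr n (newV k l)) =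
      cf n (zD u.1 l) * xvr n (embA k l u) - xvr n (newV k l)
    rw [div_mul_eq_mul_div, div_eq_iff h']
    ring

/-- the factors of the denominator coming from the color `l` itself. -/
def selfE (k : Fin n → ℕ) (l : Fin n) : Pk n (k + unitVec l) :=
  ∏ u : Vars n k, if u.1 = l then X (embA k l u) - X (newV k l) else 1

/-- a factor of `Dpoly`. -/
def dfac {m : Fin n → ℕ} (u w : Vars n m) : Pk n m :=
  if u.1 < w.1 ∧ aD n (u.1.1 + 1) (w.1.1 + 1) ≠ 0 then X u - X w else 1

lemma Dpoly_eq (m : Fin n → ℕ) : Dpoly n (aD n) m = ∏ u : Vars n m, ∏ w : Vars n m, dfac u w := by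
  rw [← prod_vars₂]
  unfold Dpoly dfac
  refine Finset.prod_congr rfl fun i _ => Finset.prod_congr rfl fun j _ => ?_
  split_ifs <;> simp

lemma Dpoly_add (k : Fin n → ℕ) (l : Fin n) : ∃ ε : KK, (ε = 1 ∨ ε = -1) ∧
    Dpoly n (aD n) (k + unitVec l) * selfE k l =
      C ε * rename (embA k l) (Dpoly n (aD n) k) * ∏ u, facE k l u := by
  have key : ∀ s : Finset (Vars n k), ∃ ε : KK, (ε = 1 ∨ ε = -1) ∧
      ∏ u ∈ s, (dfac (newV k l) (embA k l u) * dfac (embA k l u) (newV k l) *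
        (if u.1 = l then X (embA k l u) - X (newV k l) else 1)) = C ε * ∏ u ∈ s, facE k l u := by
    classical
    intro s
    induction s using Finset.induction_on with
    | empty => exact ⟨1, Or.inl rfl, by simp⟩
    | insert u s hu ih =>
      obtain ⟨ε, hε, h⟩ := ih
      rw [Finset.prod_insert hu, Finset.prod_insert hu, h]
      have h1 : (newV k l).1 = l := rfl
      have h2 : (embA k l u).1 = u.1 := rfl
      unfold dfac facE
      rw [h1, h2, aD_symm n (l.1 + 1)]
      by_cases h0 : aD n (u.1.1 + 1) (l.1 + 1) = 0
      · have h3 : u.1 ≠ l := by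
          intro h3
          rw [h3, aD_self] at h0
          norm_num at h0
        exact ⟨ε, hε, by simp [h0, h3]⟩
      · rcases lt_trichotomy u.1 l with h3 | h3 | h3
        · refine ⟨ε, hε, ?_⟩
          simp only [h0, h3, h3.ne, h3.not_gt, ne_eq, not_false_iff, and_true, if_true,
            if_false]
          ring
        · refine ⟨ε, hε, ?_⟩
          rw [if_neg h0, if_neg fun h => h3.le.not_gt h.1, if_neg fun h => h3.ge.not_gt h.1,
            if_pos h3]
          ring
        · refine ⟨-ε, by rcases hε with rfl | rfl <;> simp, ?_⟩
          simp only [h0, h3, h3.ne', h3.not_gt, ne_eq, not_false_iff, and_true, if_true,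
            if_false, map_neg]
          ring
  obtain ⟨ε, hε, h⟩ := key Finset.univ
  refine ⟨ε, hε, ?_⟩
  have h0 : dfac (newV k l) (newV k l) = 1 := by simp [dfac]
  have h1 : rename (embA k l) (Dpoly n (aD n) k) =
      ∏ u : Vars n k, ∏ w : Vars n k, dfac (embA k l u) (embA k l w) := by
    rw [Dpoly_eq, map_prod]
    refine Finset.prod_congr rfl fun u _ => ?_
    rw [map_prod]
    refine Finset.prod_congr rfl fun w _ => ?_
    unfold dfac
    rw [apply_ite (rename (embA k l))]
    simp
    rfl
  rw [Dpoly_eq, prod_vars_add, prod_vars_add, h0, one_mul]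
  simp only [prod_vars_add]
  rw [h1, selfE]
  simp only [Finset.prod_mul_distrib] at h ⊢
  linear_combination (∏ u : Vars n k, ∏ w : Vars n k, dfac (embA k l u) (embA k l w)) * h

lemma xProd_add (k : Fin n → ℕ) (l : Fin n) :
    xProd n (k + unitVec l) = X (newV k l) * rename (embA k l) (xProd n k) := by
  unfold xProd
  rw [prod_vars_add, map_prod]
  simp

/-- the numerator of the unsymmetrized bracket. -/
def numB (k : Fin n → ℕ) (l : Fin n) (g : Pk n k) (e : ℕ) (a : KK) : Pk n (k + unitVec l) :=
  rename (embA k l) g * X (newV k l) ^ e * (∏ u, facR k l u - C a * ∏ u, facL k l u)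

lemma rawB_mul (k : Fin n → ℕ) (l : Fin n) (F : Fk n k) (g : Pk n k) (r : ℤ) (a : KK) (M : ℕ)
    (e : ℕ) (he : (e : ℤ) = r + M)
    (hg : F * algebraMap (Pk n k) (Fk n k) (Dpoly n (aD n) k * xProd n k ^ M) =
      algebraMap (Pk n k) (Fk n k) g) :
    ∃ ε : KK, (ε = 1 ∨ ε = -1) ∧
    rawB (aD n) (dD n) k l F r a *
      algebraMap (Pk n (k + unitVec l)) (Fk n (k + unitVec l))
        (Dpoly n (aD n) (k + unitVec l) * xProd n (k + unitVec l) ^ M) *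
      algebraMap _ _ (selfE k l) = algebraMap _ _ (C ε * numB k l g e a) := by
  obtain ⟨ε, hε, hD⟩ := Dpoly_add k l
  refine ⟨ε, hε, ?_⟩
  have h1 : (∏ u : Vars n k,
      zetaF (aD n) (dD n) u.1 l (xvr n (embA k l u)) (xvr n (newV k l))) *
      algebraMap _ (Fk n (k + unitVec l)) (∏ u, facE k l u) =
      algebraMap _ _ (∏ u, facR k l u) := by
    rw [map_prod, map_prod, ← Finset.prod_mul_distrib]
    exact Finset.prod_congr rfl fun u _ => zetaF_mul_facE_right k l u
  have h2 : (∏ u : Vars n k,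
      zetaF (aD n) (dD n) l u.1 (xvr n (newV k l)) (xvr n (embA k l u))) *
      algebraMap _ (Fk n (k + unitVec l)) (∏ u, facE k l u) =
      algebraMap _ _ (∏ u, facL k l u) := by
    rw [map_prod, map_prod, ← Finset.prod_mul_distrib]
    exact Finset.prod_congr rfl fun u _ => zetaF_mul_facE_left k l u
  have h3 : liftHom n (embA k l) (embA_inj k l) F *
      algebraMap _ _ (rename (embA k l) (Dpoly n (aD n) k) * rename (embA k l) (xProd n k) ^ M) =
      algebraMap _ _ (rename (embA k l) g) := by
    have := congrArg (liftHom n (embA k l) (embA_inj k l)) hg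
    rwa [map_mul (liftHom n (embA k l) (embA_inj k l)), liftHom_algebraMap, liftHom_algebraMap,
      map_mul (rename (embA k l)), map_pow] at this
  have hz : xvr n (newV k l) ≠ 0 := by
    unfold xvr
    exact (map_ne_zero_iff _ (IsFractionRing.injective _ _)).mpr (MvPolynomial.X_ne_zero _)
  have h4 : xvr n (newV k l) ^ r * xvr n (newV k l) ^ M = xvr n (newV k l) ^ e := by
    rw [← zpow_natCast, ← zpow_natCast, he, zpow_add₀ hz]
  rw [mul_assoc, ← map_mul, show Dpoly n (aD n) (k + unitVec l) * xProd n (k + unitVec l) ^ M *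
    selfE k l = (Dpoly n (aD n) (k + unitVec l) * selfE k l) * xProd n (k + unitVec l) ^ M by ring,
    hD, xProd_add]
  unfold rawB rawR rawL numB
  simp only [map_mul, map_sub, map_pow, ← cf_eq] at h1 h2 h3 ⊢
  rw [← h1, ← h2, ← h3]
  change _ = cf n ε * (_ * (xvr n (newV k l)) ^ e * _)
  rw [← h4]
  change _ * (_ * (xvr n (newV k l) * _) ^ M) = _
  rw [mul_pow]
  ring

/-- evaluation of the `t`-th variable of color `c` at `sv c t`. -/
def pt {R : Type*} (sv : ℕ → ℕ → R) (m : Fin n → ℕ) : Vars n m → R := fun u => sv (u.1.1 + 1) u.2.1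

lemma X_sub_X_dvd_sub {σ : Type*} {f : σ → σ} {a b : σ}
    (h : ∀ u, f u = u ∨ (f u = a ∧ u = b) ∨ (f u = b ∧ u = a)) (p : MvPolynomial σ KK) :
    (X a - X b : MvPolynomial σ KK) ∣ p - rename f p := by
  rw [← Ideal.mem_span_singleton, ← Ideal.Quotient.mk_eq_mk_iff_sub_mem]
  set I := Ideal.span {(X a - X b : MvPolynomial σ KK)} with hI
  have hab : Ideal.Quotient.mk I (X a) = Ideal.Quotient.mk I (X b) :=
    (Ideal.Quotient.mk_eq_mk_iff_sub_mem _ _).mpr (Ideal.subset_span rfl)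
  have : Ideal.Quotient.mkₐ KK I = (Ideal.Quotient.mkₐ KK I).comp (rename f) := by
    refine MvPolynomial.algHom_ext fun u => ?_
    simp only [AlgHom.comp_apply, MvPolynomial.rename_X, Ideal.Quotient.mkₐ_eq_mk]
    rcases h u with h | ⟨h1, h2⟩ | ⟨h1, h2⟩
    · rw [h]
    · rw [h1, h2, hab]
    · rw [h1, h2, hab]
  exact congrArg (fun φ => φ p) this

lemma rename_perm_Dpoly {m : Fin n → ℕ} (σ : ∀ i, Equiv.Perm (Fin (m i))) :
    rename (permVf n σ) (Dpoly n (aD n) m) = Dpoly n (aD n) m := by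
  rw [Dpoly_eq, map_prod]
  refine Eq.trans ?_ (Equiv.prod_comp (permVEquiv σ) _)
  refine Finset.prod_congr rfl fun u _ => ?_
  rw [map_prod]
  refine Eq.trans ?_ (Equiv.prod_comp (permVEquiv σ) _)
  refine Finset.prod_congr rfl fun w _ => ?_
  unfold dfac
  rw [apply_ite (rename (permVf n σ))]
  simp
  rfl

lemma rename_perm_xProd {m : Fin n → ℕ} (σ : ∀ i, Equiv.Perm (Fin (m i))) :
    rename (permVf n σ) (xProd n m) = xProd n m := by
  unfold xProd
  rw [map_prod]
  refine Eq.trans ?_ (Equiv.prod_comp (permVEquiv σ) _)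
  refine Finset.prod_congr rfl fun u _ => ?_
  simp
  rfl

variable {R : Type*} [CommRing R] [Algebra KK R] (sv : ℕ → ℕ → R)

/-- the specialized value of `∏ facR`. -/
def valR (k : Fin n → ℕ) (l : Fin n) : R := ∏ u : Vars n k,
  if aD n (u.1.1 + 1) (l.1 + 1) = 0 then 1
  else sv (u.1.1 + 1) u.2.1 - algebraMap KK R (zD u.1 l) * sv (l.1 + 1) (k l)

/-- the specialized value of `∏ facL`. -/
def valL (k : Fin n → ℕ) (l : Fin n) : R := ∏ u : Vars n k,
  if aD n (u.1.1 + 1) (l.1 + 1) = 0 then 1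
  else algebraMap KK R (zD u.1 l) * sv (u.1.1 + 1) u.2.1 - sv (l.1 + 1) (k l)

lemma aeval_pt_numB (k : Fin n → ℕ) (l : Fin n) (g : Pk n k) (e : ℕ) (a : KK) :
    aeval (pt sv (k + unitVec l)) (numB k l g e a) =
      aeval (pt sv k) g * sv (l.1 + 1) (k l) ^ e *
        (valR sv k l - algebraMap KK R a * valL sv k l) := by
  have h1 : ∀ u, pt sv (k + unitVec l) (embA k l u) = sv (u.1.1 + 1) u.2.1 := fun u => rfl
  have h2 : pt sv (k + unitVec l) (newV k l) = sv (l.1 + 1) (k l) := rfl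
  have h3 : pt sv (k + unitVec l) ∘ embA k l = pt sv k := rfl
  unfold numB valR valL
  simp only [map_mul, map_pow, map_sub, map_prod, MvPolynomial.aeval_rename, h3,
    MvPolynomial.aeval_X, h2, MvPolynomial.aeval_C, facR, facL, apply_ite (aeval _), h1, map_one]

lemma braS_numerator_of_zero (k : Fin n → ℕ) (l : Fin n) (hk : k l = 0) (F : Fk n k) (hF : SymF F)
    (g : Pk n k) (r : ℤ) (a : KK) (M : ℕ) (e : ℕ) (he : (e : ℤ) = r + M)
    (hg : F * algebraMap (Pk n k) (Fk n k) (Dpoly n (aD n) k * xProd n k ^ M) =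
      algebraMap (Pk n k) (Fk n k) g) :
    ∃ (ε : KK) (g' : Pk n (k + unitVec l)), (ε = 1 ∨ ε = -1) ∧
      braS (aD n) (dD n) k l F r a *
        algebraMap (Pk n (k + unitVec l)) (Fk n (k + unitVec l))
          (Dpoly n (aD n) (k + unitVec l) * xProd n (k + unitVec l) ^ M) = algebraMap _ _ g' ∧
      aeval (pt sv (k + unitVec l)) g' = algebraMap KK R ε *
        (aeval (pt sv k) g * sv (l.1 + 1) 0 ^ e *
          (valR sv k l - algebraMap KK R a * valL sv k l)) := by
  obtain ⟨ε, hε, h⟩ := rawB_mul k l F g r a M e he hg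
  have h1 : selfE k l = 1 := by
    refine Finset.prod_eq_one fun u _ => ?_
    rw [if_neg]
    intro hu
    have h1 : k u.1 = 0 := by rw [hu, hk]
    have := u.2.2
    omega
  rw [h1, map_one, mul_one] at h
  refine ⟨ε, C ε * numB k l g e a, hε, ?_, ?_⟩
  · rw [braS_of_zero _ _ k l hk F hF, h]
  · rw [map_mul, aeval_pt_numB, MvPolynomial.aeval_C, hk]

lemma braS_numerator_of_one (k : Fin n → ℕ) (l : Fin n) (hk : k l = 1) (F : Fk n k) (hF : SymF F)
    (g : Pk n k) (r : ℤ) (a : KK) (M : ℕ) (e : ℕ) (he : (e : ℤ) = r + M)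
    (hg : F * algebraMap (Pk n k) (Fk n k) (Dpoly n (aD n) k * xProd n k ^ M) =
      algebraMap (Pk n k) (Fk n k) g)
    (h0 : ∃ u : Vars n k, u.1 ≠ l ∧ aD n (u.1.1 + 1) (l.1 + 1) ≠ 0 ∧
      sv (u.1.1 + 1) u.2.1 = algebraMap KK R (zD u.1 l) * sv (l.1 + 1) 0)
    (h0' : ∃ u : Vars n k, u.1 ≠ l ∧ aD n (u.1.1 + 1) (l.1 + 1) ≠ 0 ∧
      algebraMap KK R (zD u.1 l) * sv (u.1.1 + 1) u.2.1 = sv (l.1 + 1) 0) :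
    ∃ (ε : KK) (g' : Pk n (k + unitVec l)), (ε = 1 ∨ ε = -1) ∧
      braS (aD n) (dD n) k l F r a *
        algebraMap (Pk n (k + unitVec l)) (Fk n (k + unitVec l))
          (Dpoly n (aD n) (k + unitVec l) * xProd n (k + unitVec l) ^ M) = algebraMap _ _ g' ∧
      aeval (pt sv (k + unitVec l)) g' * (sv (l.1 + 1) 0 - sv (l.1 + 1) 1) = algebraMap KK R ε *
        (aeval (pt sv k) g * sv (l.1 + 1) 1 ^ e *
          (valR sv k l - algebraMap KK R a * valL sv k l)) := by
  obtain ⟨ε, hε, h⟩ := rawB_mul k l F g r a M e he hg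
  set N := numB k l g e a with hN
  set τ := permVf n (swapP k l) with hτ
  have hl0 : 0 < k l := by omega
  set z0 : Vars n k := ⟨l, ⟨0, hl0⟩⟩ with hz0
  have hz0τ : τ (embA k l z0) = newV k l := permVf_swapP_zero k l _
  have hzτ : τ (newV k l) = embA k l z0 := permVf_swapP_newV k l
  have hneτ : ∀ u : Vars n k, u.1 ≠ l → τ (embA k l u) = embA k l u := fun u hu =>
    permVf_swapP_of_ne k l _ hu
  have hu0 : ∀ u : Vars n k, u.1 = l → u = z0 := by
    rintro ⟨i, b⟩ hu
    obtain rfl : i = l := hu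
    have := b.2
    rw [hz0]
    congr 1
    exact Fin.ext (by simp only; omega)
  have h1 : selfE k l = X (embA k l z0) - X (newV k l) := by
    unfold selfE
    rw [Finset.prod_eq_single z0]
    · rw [if_pos rfl]
    · intro u _ hu
      rw [if_neg fun h => hu (hu0 u h)]
    · intro h; exact absurd (Finset.mem_univ _) h
  rw [h1] at h
  obtain ⟨q, hq⟩ := X_sub_X_dvd_sub (f := τ) (a := embA k l z0) (b := newV k l) (by
    intro u
    rcases eq_embA_or_newV k l u with ⟨w, rfl⟩ | rfl
    · by_cases hw : w.1 = l
      · rw [hu0 w hw]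
        exact Or.inr (Or.inr ⟨hz0τ, rfl⟩)
      · exact Or.inl (hneτ w hw)
    · exact Or.inr (Or.inl ⟨hzτ, rfl⟩)) N
  have hne := X_sub_X_ne_zero (embA_ne_newV k l z0)
  have hne' : algebraMap (Pk n (k + unitVec l)) (Fk n (k + unitVec l))
      (X (embA k l z0) - X (newV k l)) ≠ 0 :=
    (map_ne_zero_iff _ (IsFractionRing.injective _ _)).mpr hne
  have hsw : aeval (pt sv (k + unitVec l)) (rename τ N) = 0 := by
    have hr : aeval (pt sv (k + unitVec l)) (rename τ (∏ u, facR k l u)) = 0 := by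
      obtain ⟨u, hul, hu, hu1⟩ := h0
      rw [map_prod, map_prod]
      refine Finset.prod_eq_zero (Finset.mem_univ u) ?_
      unfold facR
      rw [if_neg hu, map_sub, map_mul, MvPolynomial.rename_X, MvPolynomial.rename_X,
        MvPolynomial.rename_C, hneτ u hul, hzτ, map_sub, map_mul, MvPolynomial.aeval_X,
        MvPolynomial.aeval_X, MvPolynomial.aeval_C]
      exact sub_eq_zero.mpr hu1
    have hl : aeval (pt sv (k + unitVec l)) (rename τ (∏ u, facL k l u)) = 0 := by
      obtain ⟨u, hul, hu, hu1⟩ := h0'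
      rw [map_prod, map_prod]
      refine Finset.prod_eq_zero (Finset.mem_univ u) ?_
      unfold facL
      rw [if_neg hu, map_sub, map_mul, MvPolynomial.rename_X, MvPolynomial.rename_X,
        MvPolynomial.rename_C, hneτ u hul, hzτ, map_sub, map_mul, MvPolynomial.aeval_X,
        MvPolynomial.aeval_X, MvPolynomial.aeval_C]
      exact sub_eq_zero.mpr hu1
    rw [hN]
    unfold numB
    simp only [map_mul, map_sub, hr, hl, mul_zero, sub_self]
  refine ⟨ε, C ε * q, hε, ?_, ?_⟩
  · rw [braS_of_one _ _ k l hk F hF]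
    have h2 := congrArg (permF n (swapP k l)) h
    rw [map_mul, map_mul] at h2
    have hP : ∀ p, permF n (swapP k l) (algebraMap _ _ p) = algebraMap _ _ (rename τ p) :=
      liftHom_algebraMap _ _
    have hD : rename τ (Dpoly n (aD n) (k + unitVec l)) = Dpoly n (aD n) (k + unitVec l) :=
      rename_perm_Dpoly _
    have hX : rename τ (xProd n (k + unitVec l)) = xProd n (k + unitVec l) :=
      rename_perm_xProd _
    rw [hP, hP, hP, map_mul (rename τ), map_mul (rename τ), map_pow, hD, hX,
      map_sub (rename (R := KK) τ), MvPolynomial.rename_X, MvPolynomial.rename_X, hz0τ, hzτ,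
        MvPolynomial.rename_C] at h2
    refine mul_right_cancel₀ hne' ?_
    rw [add_mul, add_mul, h]
    have h4 : algebraMap (Pk n (k + unitVec l)) (Fk n (k + unitVec l))
        (X (newV k l) - X (embA k l z0)) =
          -algebraMap _ _ (X (embA k l z0) - X (newV k l) : Pk n (k + unitVec l)) := by
      rw [← map_neg, neg_sub]
    rw [h4, mul_neg, neg_eq_iff_eq_neg] at h2
    rw [h2, ← sub_eq_add_neg, ← map_sub, ← map_mul]
    refine congrArg _ ?_
    linear_combination C ε * hq
  · rw [map_mul, MvPolynomial.aeval_C, mul_assoc]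
    congr 1
    have h3 := congrArg (aeval (pt sv (k + unitVec l))) hq
    rw [map_sub, hsw, sub_zero, hN, aeval_pt_numB, map_mul, map_sub, MvPolynomial.aeval_X,
      MvPolynomial.aeval_X, hk] at h3
    rw [h3, mul_comm]
    unfold pt newV embA emb1f
    simp only [hk]
    rfl

end Numerators

section Specializations
variable {n : ℕ}

/-- `V m` is `v^m` in a `ℚ(v)`-algebra. -/
abbrev V (R : Type*) [CommRing R] [Algebra KK R] (m : ℤ) : R := algebraMap KK R (vpow m)

lemma vpow_add (a b : ℤ) : vpow (a + b) = vpow a * vpow b :=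
  zpow_add₀ RatFunc.X_ne_zero a b

lemma vpow_zero : vpow 0 = 1 := zpow_zero _

lemma vpow_ne_zero (a : ℤ) : vpow a ≠ 0 := zpow_ne_zero _ RatFunc.X_ne_zero

lemma V_mul (R : Type*) [CommRing R] [Algebra KK R] (a b : ℤ) : V R a * V R b = V R (a + b) := by
  rw [V, V, V, vpow_add, map_mul]

lemma V_zero (R : Type*) [CommRing R] [Algebra KK R] : V R 0 = 1 := by
  rw [V, vpow_zero, map_one]

/-- the degree vector of a word in the 1-based colors. -/
def cnt (n : ℕ) (W : List ℕ) : Fin n → ℕ := fun i => W.count (i.1 + 1)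

lemma cnt_append (W : List ℕ) (l : Fin n) : cnt n (W ++ [l.1 + 1]) = cnt n W + unitVec l := by
  funext i
  simp [cnt, unitVec, List.count_singleton, Fin.ext_iff, eq_comm (a := i.1)]

lemma cnt_singleton (l : Fin n) : cnt n [l.1 + 1] = unitVec l := by
  funext i
  simp [cnt, unitVec, List.count_singleton, Fin.ext_iff, eq_comm (a := i.1)]

lemma prod_cnt {R : Type*} [CommMonoid R] (W : List ℕ) (f : ℕ → ℕ → R) :
    ∏ u : Vars n (cnt n W), f (u.1.1 + 1) u.2.1 =
      ∏ c ∈ Finset.Icc 1 n, ∏ t ∈ Finset.range (W.count c), f c t := by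
  rw [← prod_vars fun u : Vars n (cnt n W) => f (u.1.1 + 1) u.2.1]
  have h : ∀ i : Fin n, ∏ r : Fin (cnt n W i), f (i.1 + 1) r.1 =
      ∏ t ∈ Finset.range (W.count (i.1 + 1)), f (i.1 + 1) t := fun i =>
    Fin.prod_univ_eq_prod_range (f (i.1 + 1)) (W.count (i.1 + 1))
  simp only [h]
  rw [Fin.prod_univ_eq_prod_range
    (fun i => ∏ t ∈ Finset.range (W.count (i + 1)), f (i + 1) t) n]
  refine Finset.prod_bij (fun i _ => i + 1) ?_ ?_ ?_ ?_
  · intro i hi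
    simp only [Finset.mem_range, Finset.mem_Icc] at hi ⊢
    omega
  · intro i _ j _ h
    omega
  · intro c hc
    simp only [Finset.mem_range, Finset.mem_Icc] at hc ⊢
    exact ⟨c - 1, by omega, by omega⟩
  · intro i _; rfl

variable {R : Type*} [CommRing R] [Algebra KK R] (sv : ℕ → ℕ → R)

lemma valR_cnt (W : List ℕ) (l : Fin n) (S : Finset ℕ) (hS : S ⊆ Finset.Icc 1 n)
    (h : ∀ c ∈ S, aD n c (l.1 + 1) ≠ 0)
    (h' : ∀ c ∈ Finset.Icc 1 n, c ∉ S → aD n c (l.1 + 1) = 0 ∨ W.count c = 0) :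
    valR sv (cnt n W) l = ∏ c ∈ S, ∏ t ∈ Finset.range (W.count c),
      (sv c t - V R (-aD n c (l.1 + 1)) * sv (l.1 + 1) (W.count (l.1 + 1))) := by
  unfold valR
  rw [prod_cnt W fun c t => if aD n c (l.1 + 1) = 0 then 1
    else sv c t - algebraMap KK R (vpow (-aD n c (l.1 + 1))) * sv (l.1 + 1) (cnt n W l),
    ← Finset.prod_subset hS]
  · refine Finset.prod_congr rfl fun c hc => ?_
    simp only [if_neg (h c hc)]
    rfl
  · intro c hc hcS
    rcases h' c hc hcS with h0 | h0
    · simp [h0]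
    · rw [h0, Finset.range_zero, Finset.prod_empty]

lemma valL_cnt (W : List ℕ) (l : Fin n) (S : Finset ℕ) (hS : S ⊆ Finset.Icc 1 n)
    (h : ∀ c ∈ S, aD n c (l.1 + 1) ≠ 0)
    (h' : ∀ c ∈ Finset.Icc 1 n, c ∉ S → aD n c (l.1 + 1) = 0 ∨ W.count c = 0) :
    valL sv (cnt n W) l = ∏ c ∈ S, ∏ t ∈ Finset.range (W.count c),
      (V R (-aD n c (l.1 + 1)) * sv c t - sv (l.1 + 1) (W.count (l.1 + 1))) := by
  unfold valL
  rw [prod_cnt W fun c t => if aD n c (l.1 + 1) = 0 then 1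
    else algebraMap KK R (vpow (-aD n c (l.1 + 1))) * sv c t - sv (l.1 + 1) (cnt n W l),
    ← Finset.prod_subset hS]
  · refine Finset.prod_congr rfl fun c hc => ?_
    simp only [if_neg (h c hc)]
    rfl
  · intro c hc hcS
    rcases h' c hc hcS with h0 | h0
    · simp [h0]
    · rw [h0, Finset.range_zero, Finset.prod_empty]

/-- `Ψ x` is homogeneous of degree `k`, and its numerator specializes to `G`. -/
def SpecializesTo (Ψ : UD n →ₗ[KK] BigS n) (M : ℕ) (k : Fin n → ℕ) (x : UD n) (G : R) : Prop :=
  ∃ (F : Fk n k) (g : Pk n k), Ψ x = DirectSum.of (fun k => Fk n k) k F ∧ SymF F ∧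
    F * algebraMap (Pk n k) (Fk n k) (Dpoly n (aD n) k * xProd n k ^ M) =
      algebraMap (Pk n k) (Fk n k) g ∧ aeval (pt sv k) g = G

section Steps
variable (Ψ : UD n →ₗ[KK] BigS n)
  (hmul : ∀ a b, Ψ (a * b) = bstar n (aD n) (dD n) (Ψ a) (Ψ b))
  (hgen : ∀ (i : Fin n) (r : ℤ), Ψ (ug n (aD n) (dD n) i r) =
    DirectSum.of (fun k => Fk n k) (unitVec i)
      (xvr n (⟨i, ⟨0, by simp [unitVec]⟩⟩ : Vars n (unitVec i)) ^ r))
  (M : ℕ)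

include hgen in
lemma specializesTo_gen (l : Fin n) (r : ℤ) (e : ℕ) (he : (e : ℤ) = r + M) :
    SpecializesTo sv Ψ M (unitVec l) (ug n (aD n) (dD n) l r) (sv (l.1 + 1) 0 ^ e) := by
  refine ⟨_, X ⟨l, ⟨0, by simp [unitVec]⟩⟩ ^ e, hgen l r, ?_, ?_, ?_⟩
  · intro σ
    unfold permF
    rw [map_zpow₀, liftHom_xvr]
    congr 2
    exact (Unique.eq_default _).trans (default_vars l).symm
  · have h1 : Dpoly n (aD n) (unitVec l) = 1 := by
      rw [Dpoly_eq]
      refine Finset.prod_eq_one fun u _ => Finset.prod_eq_one fun w _ => ?_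
      rw [Subsingleton.elim u w, dfac, if_neg fun h => lt_irrefl _ h.1]
    have h2 : xProd n (unitVec l) = X ⟨l, ⟨0, by simp [unitVec]⟩⟩ := by
      unfold xProd
      rw [Fintype.prod_unique, default_vars l]
    have hz : xvr n (⟨l, ⟨0, by simp [unitVec]⟩⟩ : Vars n (unitVec l)) ≠ 0 := by
      unfold xvr
      exact (map_ne_zero_iff _ (IsFractionRing.injective _ _)).mpr (MvPolynomial.X_ne_zero _)
    rw [h1, one_mul, h2, map_pow, map_pow]
    change xvr n _ ^ r * xvr n _ ^ M = xvr n _ ^ e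
    rw [← zpow_natCast, ← zpow_natCast, he, zpow_add₀ hz]
  · rw [map_pow, MvPolynomial.aeval_X]
    rfl

include hmul hgen in
lemma SpecializesTo.bracket_of_zero {k : Fin n → ℕ} {x : UD n} {G : R}
    (h : SpecializesTo sv Ψ M k x G) (l : Fin n) (hk : k l = 0) (r : ℤ) (a : KK) (e : ℕ)
    (he : (e : ℤ) = r + M) :
    ∃ ε : KK, (ε = 1 ∨ ε = -1) ∧ SpecializesTo sv Ψ M (k + unitVec l)
      (x * ug n (aD n) (dD n) l r - a • (ug n (aD n) (dD n) l r * x))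
      (algebraMap KK R ε * (G * sv (l.1 + 1) 0 ^ e *
        (valR sv k l - algebraMap KK R a * valL sv k l))) := by
  obtain ⟨F, g, hx, hF, hg, rfl⟩ := h
  obtain ⟨ε, g', hε, h1, h2⟩ := braS_numerator_of_zero sv k l hk F hF g r a M e he hg
  exact ⟨ε, hε, _, g', bracket_of (aD n) (dD n) Ψ hmul k l (by omega) F r a _ _ hx (hgen l r),
    symF_braS _ _ k l F r a, h1, h2⟩

include hmul hgen in
lemma SpecializesTo.bracket_of_one {k : Fin n → ℕ} {x : UD n} {G : R}
    (h : SpecializesTo sv Ψ M k x G) (l : Fin n) (hk : k l = 1) (r : ℤ) (a : KK) (e : ℕ)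
    (he : (e : ℤ) = r + M)
    (h0 : ∃ u : Vars n k, u.1 ≠ l ∧ aD n (u.1.1 + 1) (l.1 + 1) ≠ 0 ∧
      sv (u.1.1 + 1) u.2.1 = algebraMap KK R (zD u.1 l) * sv (l.1 + 1) 0)
    (h0' : ∃ u : Vars n k, u.1 ≠ l ∧ aD n (u.1.1 + 1) (l.1 + 1) ≠ 0 ∧
      algebraMap KK R (zD u.1 l) * sv (u.1.1 + 1) u.2.1 = sv (l.1 + 1) 0) :
    ∃ (ε : KK) (G' : R), (ε = 1 ∨ ε = -1) ∧ SpecializesTo sv Ψ M (k + unitVec l)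
      (x * ug n (aD n) (dD n) l r - a • (ug n (aD n) (dD n) l r * x)) G' ∧
      G' * (sv (l.1 + 1) 0 - sv (l.1 + 1) 1) =
        algebraMap KK R ε * (G * sv (l.1 + 1) 1 ^ e *
          (valR sv k l - algebraMap KK R a * valL sv k l)) := by
  obtain ⟨F, g, hx, hF, hg, rfl⟩ := h
  obtain ⟨ε, g', hε, h1, h2⟩ := braS_numerator_of_one sv k l hk F hF g r a M e he hg h0 h0'
  exact ⟨ε, _, hε, ⟨_, g', bracket_of (aD n) (dD n) Ψ hmul k l (by omega) F r a _ _ hx (hgen l r),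
    symF_braS _ _ k l F r a, h1, rfl⟩, h2⟩

end Steps
end Specializations

section BracketSteps
variable {n : ℕ}

/-- the first specialization parameter `w` of `β`. -/
abbrev wv (β : PosRootD n) : WR2D n := X (Sum.inl (β, 0))

/-- the second specialization parameter `w'` of `β`. -/
abbrev wv' (β : PosRootD n) : WR2D n := X (Sum.inr (β, 0))

/-- the values of the specialization map of `β`. -/
abbrev svD (β : PosRootD n) (c t : ℕ) : WR2D n := specValD n β 0 t c

lemma svD_zero (β : PosRootD n) {c : ℕ} (hc : c ≠ n) : svD β c 0 = V _ (1 - (c : ℤ)) * wv β := by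
  simp [svD, specValD, hc]

lemma svD_zero_last (β : PosRootD n) : svD β n 0 = V _ (2 - (n : ℤ)) * wv β := by
  simp [svD, specValD]

lemma svD_one (β : PosRootD n) (hβ : isSpecD β) (c : ℕ) :
    svD β c 1 = V _ ((c : ℤ) + 3 - 2 * n) * wv' β := by
  simp [svD, specValD, hβ]

lemma exists_svD_zero (β : PosRootD n) (c : ℕ) : ∃ m : ℤ, svD β c 0 = V _ m * wv β := by
  by_cases hc : c = n
  · subst hc; exact ⟨_, svD_zero_last β⟩
  · exact ⟨_, svD_zero β hc⟩

/-- a nonzero rational multiple of `v^m⟨1⟩^j`. -/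
def IsBracketMonomial (a : KK) (j : ℕ) : Prop :=
  ∃ (c : ℚ) (m : ℤ), c ≠ 0 ∧ a = algebraMap ℚ KK c * vpow m * qBrack 1 ^ j

lemma IsBracketMonomial.mul {a b : KK} {i j : ℕ} (ha : IsBracketMonomial a i)
    (hb : IsBracketMonomial b j) : IsBracketMonomial (a * b) (i + j) := by
  obtain ⟨c, m, hc, rfl⟩ := ha
  obtain ⟨d, l, hd, rfl⟩ := hb
  exact ⟨c * d, m + l, mul_ne_zero hc hd, by rw [map_mul, vpow_add, pow_add]; ring⟩

lemma isBracketMonomial_vpow (m : ℤ) : IsBracketMonomial (vpow m) 0 :=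
  ⟨1, m, one_ne_zero, by simp⟩

lemma isBracketMonomial_sign {ε : KK} (h : ε = 1 ∨ ε = -1) : IsBracketMonomial ε 0 := by
  rcases h with rfl | rfl
  · exact ⟨1, 0, one_ne_zero, by simp [vpow]⟩
  · exact ⟨-1, 0, by norm_num, by simp [vpow]⟩

lemma isBracketMonomial_qBrack : IsBracketMonomial (qBrack 1) 1 :=
  ⟨1, 0, one_ne_zero, by simp [vpow]⟩

lemma IsVpow.isBracketMonomial {a : KK} (h : IsVpow a) : IsBracketMonomial a 0 := by
  obtain ⟨m, rfl⟩ := h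
  exact isBracketMonomial_vpow m

/-- the factor of `B_β` indexed by `l`. -/
def bFac (β : PosRootD n) (l : ℕ) : WR2D n :=
  (wv β - V _ (2 * l + 4 - 2 * n) * wv' β) * (wv β - V _ (2 * l - 2 * n) * wv' β)

/-- the product of the factors of `B_β` for the colors that occur twice in `W`. -/
def bWord (β : PosRootD n) (W : List ℕ) : WR2D n :=
  ∏ c ∈ Finset.Icc 1 (n - 2), if 2 ≤ W.count c then bFac β c else 1

lemma count_append_self (W : List ℕ) (L : ℕ) : (W ++ [L]).count L = W.count L + 1 := by simp

lemma count_append_of_ne (W : List ℕ) {L c : ℕ} (h : c ≠ L) :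
    (W ++ [L]).count c = W.count c := by
  simp [List.count_append, Ne.symm h]

lemma bWord_append_of_zero (β : PosRootD n) (W : List ℕ) (L : ℕ) (h : W.count L = 0) :
    bWord β (W ++ [L]) = bWord β W := by
  refine Finset.prod_congr rfl fun c _ => ?_
  by_cases hc : c = L
  · subst hc
    rw [count_append_self, h, if_neg (by omega), if_neg (by omega)]
  · rw [count_append_of_ne W hc]

lemma bWord_append_of_one (β : PosRootD n) (W : List ℕ) (L : ℕ) (h : W.count L = 1)
    (hL : L ∈ Finset.Icc 1 (n - 2)) :
    bWord β (W ++ [L]) = bWord β W * bFac β L := by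
  unfold bWord
  rw [← Finset.mul_prod_erase _ _ hL, ← Finset.mul_prod_erase _ _ hL, count_append_self, h,
    if_pos (by omega), if_neg (by omega), one_mul, mul_comm]
  refine congrArg₂ (· * ·) (Finset.prod_congr rfl fun c hc => ?_) rfl
  rw [count_append_of_ne W (Finset.ne_of_mem_erase hc)]

lemma psi2D_wv (β : PosRootD n) : psi2D n (wv β) = X (β, 0) := by simp [psi2D]

lemma psi2D_wv' (β : PosRootD n) : psi2D n (wv' β) = X (β, 0) := by simp [psi2D]

lemma psi2D_algebraMap (a : KK) : psi2D n (algebraMap KK (WR2D n) a) = C a := by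
  rw [AlgHom.commutes, MvPolynomial.algebraMap_eq]

lemma genD_succ (l : Fin n) (r : ℤ) : genD n (l.1 + 1) r = ug n (aD n) (dD n) l r := by
  have := l.2
  rw [genD, g1, dif_pos (by omega)]
  rfl

/-- `x` has degree `W`, and its specialization at `β` has the expected form. -/
def HasForm (Ψ : UD n →ₗ[KK] BigS n) (M : ℕ) (β : PosRootD n) (W : List ℕ) (x : UD n) (σ : ℤ) :
    Prop :=
  ∃ (q : WR2D n) (a : KK) (j p : ℕ),
    SpecializesTo (svD β) Ψ M (cnt n W) x (bWord β W * q) ∧ psi2D n q = C a * X (β, 0) ^ p ∧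
    IsBracketMonomial a j ∧ j + 1 = W.length ∧ (p : ℤ) + 1 = σ + (M + 1) * W.length

section Steps
variable (Ψ : UD n →ₗ[KK] BigS n)
  (hmul : ∀ a b, Ψ (a * b) = bstar n (aD n) (dD n) (Ψ a) (Ψ b))
  (hgen : ∀ (i : Fin n) (r : ℤ), Ψ (ug n (aD n) (dD n) i r) =
    DirectSum.of (fun k => Fk n k) (unitVec i)
      (xvr n (⟨i, ⟨0, by simp [unitVec]⟩⟩ : Vars n (unitVec i)) ^ r))
  (M : ℕ) (β : PosRootD n)

include hgen in
lemma hasForm_gen (L : ℕ) (hL : 1 ≤ L ∧ L ≤ n) (r : ℤ) (hr : 0 ≤ r + M) :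
    HasForm Ψ M β [L] (genD n L r) r := by
  obtain ⟨l, rfl⟩ : ∃ l : Fin n, L = l.1 + 1 := ⟨⟨L - 1, by omega⟩, by simp only; omega⟩
  obtain ⟨e, he⟩ := Int.eq_ofNat_of_zero_le hr
  obtain ⟨m, hm⟩ := exists_svD_zero β (l.1 + 1)
  have h1 : bWord β [l.1 + 1] = 1 := by
    refine Finset.prod_eq_one fun c _ => ?_
    rw [if_neg]
    have := List.count_le_length (a := c) (l := [l.1 + 1])
    simp only [List.length_singleton] at this
    omega
  refine ⟨(V _ m * wv β) ^ e, vpow m ^ e, 0, e, ?_, ?_, ?_, rfl, ?_⟩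
  · rw [h1, one_mul, ← hm, cnt_singleton, genD_succ]
    exact specializesTo_gen (svD β) Ψ hgen M l r e he.symm
  · rw [map_pow, map_mul, psi2D_wv, psi2D_algebraMap, mul_pow, C.map_pow]
  · refine ⟨1, m * e, one_ne_zero, ?_⟩
    rw [map_one, one_mul, pow_zero, mul_one, vpow, vpow, zpow_mul, zpow_natCast]
  · simp only [List.length_singleton]
    push_cast
    linarith

variable {Ψ M β}

lemma HasForm.append {W : List ℕ} {x' : UD n} {σ r : ℤ} {q q' : WR2D n} {a b : KK}
    {j p e L : ℕ} (he : (e : ℤ) = r + M)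
    (h : SpecializesTo (svD β) Ψ M (cnt n (W ++ [L])) x' (bWord β (W ++ [L]) * q'))
    (hq' : psi2D n q' = C b * psi2D n q * X (β, 0) ^ (e + 1)) (hb : IsBracketMonomial b 1)
    (hq : psi2D n q = C a * X (β, 0) ^ p) (ha : IsBracketMonomial a j) (hj : j + 1 = W.length)
    (hp : (p : ℤ) + 1 = σ + (M + 1) * W.length) :
    HasForm Ψ M β (W ++ [L]) x' (σ + r) := by
  refine ⟨q', a * b, j + 1, p + (e + 1), h, ?_, ha.mul hb, by simp [hj], ?_⟩
  · rw [hq', hq, C.map_mul]; ring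
  · rw [List.length_append, List.length_singleton]
    push_cast
    linarith

lemma V_one_mul_sub (R : Type*) [CommRing R] [Algebra KK R] (z : R) :
    V R 1 * (V R 1 * z) - z = algebraMap KK R (vpow 1 * qBrack 1) * z := by
  have h : vpow 1 * qBrack 1 = vpow 2 - 1 := by
    rw [qBrack, mul_sub, ← vpow_add, ← vpow_add]
    simp [vpow]
  rw [h, ← mul_assoc, V_mul, map_sub, map_one]
  norm_num
  ring

include hmul hgen in
lemma HasForm.bracket_of_zero {W : List ℕ} {x : UD n} {σ : ℤ} (hx : HasForm Ψ M β W x σ) (L P : ℕ)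
    (hL : 1 ≤ L ∧ L ≤ n) (hP : 1 ≤ P ∧ P ≤ n) (hPL : aD n P L = -1) (hWP : W.count P = 1)
    (hWL : W.count L = 0) (hW : ∀ c, c ≠ P → aD n c L = 0 ∨ W.count c = 0)
    (hsv : svD β P 0 = V _ 1 * svD β L 0) (r : ℤ) (hr : 0 ≤ r + M) (a : KK) (ha : IsVpow a) :
    HasForm Ψ M β (W ++ [L]) (x * genD n L r - a • (genD n L r * x)) (σ + r) := by
  obtain ⟨q, b, j, p, hs, hq, hb, hj, hp⟩ := hx
  obtain ⟨l, rfl⟩ : ∃ l : Fin n, L = l.1 + 1 := ⟨⟨L - 1, by omega⟩, by simp only; omega⟩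
  obtain ⟨e, he⟩ := Int.eq_ofNat_of_zero_le hr
  obtain ⟨m, hm⟩ := exists_svD_zero β (l.1 + 1)
  obtain ⟨ε, hε, h⟩ := hs.bracket_of_zero (svD β) Ψ hmul hgen M l hWL r a e he.symm
  have hS : ({P} : Finset ℕ) ⊆ Finset.Icc 1 n := by simpa using hP
  have hR : valR (svD β) (cnt n W) l = 0 := by
    rw [valR_cnt (svD β) W l {P} hS (by simp [hPL]) (by simpa using fun c _ _ => hW c)]
    rw [Finset.prod_singleton, hWP, Finset.prod_range_one, hPL, hWL, neg_neg, hsv, sub_self]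
  have hLv : valL (svD β) (cnt n W) l =
      algebraMap KK _ (vpow 1 * qBrack 1) * svD β (l.1 + 1) 0 := by
    rw [valL_cnt (svD β) W l {P} hS (by simp [hPL]) (by simpa using fun c _ _ => hW c)]
    rw [Finset.prod_singleton, hWP, Finset.prod_range_one, hPL, hWL, neg_neg, hsv, V_one_mul_sub]
  rw [hR, hLv, zero_sub, hm, ← cnt_append, ← genD_succ] at h
  refine HasForm.append (b := ε * (-1) * a * vpow (m * (e + 1)) * (vpow 1 * qBrack 1))
    (q := q) (q' := algebraMap KK _ (ε * (-1) * a * vpow (m * (e + 1)) * (vpow 1 * qBrack 1)) *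
      q * wv β ^ (e + 1)) he.symm ?_ ?_ ?_ hq hb hj hp
  · rw [bWord_append_of_zero β W _ hWL]
    convert h using 1
    have h1 : vpow (m * (e + 1)) = vpow m ^ (e + 1) := by
      rw [vpow, vpow, zpow_mul]
      exact_mod_cast rfl
    rw [h1]
    simp only [map_mul, map_neg, map_one, map_pow]
    ring
  · rw [map_mul, map_mul, psi2D_algebraMap, map_pow, psi2D_wv]
  · exact (((((isBracketMonomial_sign hε).mul (isBracketMonomial_sign (Or.inr rfl))).mul
      ha.isBracketMonomial).mul (isBracketMonomial_vpow _)).mul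
      ((isBracketMonomial_vpow 1).mul isBracketMonomial_qBrack))

end Steps
end BracketSteps

section DoubledSteps
variable {n : ℕ}

lemma V_mul_sub_V_mul {R : Type*} [CommRing R] [Algebra KK R] (a c : ℤ) (x y : R) :
    V R a * x - V R c * y = V R a * (x - V R (c - a) * y) := by
  rw [mul_sub, ← mul_assoc (V R a) (V R (c - a)), V_mul, add_sub_cancel]

lemma svD_zero_sub_one_ne_zero (β : PosRootD n) (hβ : isSpecD β) (c : ℕ) :
    svD β c 0 - svD β c 1 ≠ 0 := by
  obtain ⟨m, hm⟩ := exists_svD_zero β c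
  rw [hm, svD_one β hβ]
  intro h
  have := congrArg (aeval (R := KK) (S₁ := KK) (Sum.elim 1 0)) h
  simp only [map_sub, map_mul, AlgHom.commutes, MvPolynomial.aeval_X, Sum.elim_inl, Sum.elim_inr,
    Pi.one_apply, Pi.zero_apply, map_zero, mul_zero, mul_one, sub_zero] at this
  exact vpow_ne_zero m this

lemma aD_pred {c L : ℕ} (h : c + 1 = L) (hL : L + 1 ≤ n) : aD n c L = -1 := by
  unfold aD
  split_ifs <;> omega

lemma aD_succ {c L : ℕ} (h : L + 1 = c) (hc : c + 1 ≤ n) : aD n c L = -1 := by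
  unfold aD
  split_ifs <;> omega

lemma aD_last {L : ℕ} (h : L + 2 = n) : aD n n L = -1 := by
  unfold aD
  split_ifs <;> omega

section Steps
variable {Ψ : UD n →ₗ[KK] BigS n}
  (hmul : ∀ a b, Ψ (a * b) = bstar n (aD n) (dD n) (Ψ a) (Ψ b))
  (hgen : ∀ (i : Fin n) (r : ℤ), Ψ (ug n (aD n) (dD n) i r) =
    DirectSum.of (fun k => Fk n k) (unitVec i)
      (xvr n (⟨i, ⟨0, by simp [unitVec]⟩⟩ : Vars n (unitVec i)) ^ r))
  {M : ℕ} {β : PosRootD n}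

include hmul hgen in
lemma HasForm.bracket_of_one (hβ : isSpecD β) {W : List ℕ} {x : UD n} {σ : ℤ}
    (hx : HasForm Ψ M β W x σ) (l : Fin n) (hl : 2 ≤ l.1 + 1 ∧ l.1 + 1 + 2 ≤ n)
    (hWl : W.count (l.1 + 1) = 1) (hWp : 0 < W.count l.1) (hWs : 0 < W.count (l.1 + 2))
    (r : ℤ) (hr : 0 ≤ r + M) (a : KK) (Q : WR2D n)
    (hQ : valR (svD β) (cnt n W) l - algebraMap KK _ a * valL (svD β) (cnt n W) l =
      bFac β (l.1 + 1) * Q * (svD β (l.1 + 1) 0 - svD β (l.1 + 1) 1))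
    (b' : KK) (hb' : psi2D n Q = C b' * X (β, 0)) (hm : IsBracketMonomial b' 1) :
    HasForm Ψ M β (W ++ [l.1 + 1])
      (x * genD n (l.1 + 1) r - a • (genD n (l.1 + 1) r * x)) (σ + r) := by
  obtain ⟨q, b, j, p, hs, hq, hb, hj, hp⟩ := hx
  obtain ⟨e, he⟩ := Int.eq_ofNat_of_zero_le hr
  have hl1 : svD β (l.1 + 1) 0 = V _ (-(l.1 : ℤ)) * wv β := by
    rw [svD_zero β (by omega)]; congr 2; push_cast; ring_nf
  obtain ⟨ε, G', hε, h, hG⟩ := hs.bracket_of_one (svD β) Ψ hmul hgen M l hWl r a e he.symm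
    ⟨⟨⟨l.1 - 1, by omega⟩, ⟨0, by simpa [cnt, show l.1 - 1 + 1 = l.1 by omega] using hWp⟩⟩,
      by simp only [ne_eq, Fin.ext_iff]; omega,
      by simp only; rw [aD_pred (by omega) (by omega)]; norm_num, by
        simp only [zD]
        rw [aD_pred (by omega) (by omega), svD_zero β (by omega), hl1, ← mul_assoc, V_mul,
          Nat.cast_add, Nat.cast_sub (by omega)]
        congr 3
        push_cast
        ring⟩
    ⟨⟨⟨l.1 + 1, by omega⟩, ⟨0, hWs⟩⟩,
      by simp only [ne_eq, Fin.ext_iff]; omega,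
      by simp only; rw [aD_succ (by omega) (by omega)]; norm_num, by
        simp only [zD]
        rw [aD_succ (by omega) (by omega), svD_zero β (by omega), hl1, ← mul_assoc, V_mul]
        congr 3
        push_cast
        ring⟩
  have hG' : G' = bWord β (W ++ [l.1 + 1]) * (algebraMap KK _ ε * q *
      svD β (l.1 + 1) 1 ^ e * Q) := by
    refine mul_right_cancel₀ (svD_zero_sub_one_ne_zero β hβ (l.1 + 1)) ?_
    rw [hG, hQ, bWord_append_of_one β W _ hWl (Finset.mem_Icc.mpr ⟨by omega, by omega⟩)]
    ring
  rw [hG', ← cnt_append, ← genD_succ] at h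
  refine HasForm.append (b := ε * vpow (((l.1 + 1 : ℕ) + 3 - 2 * n) * e) * b') he.symm h ?_ ?_
    hq hb hj hp
  · have h1 : ∀ m : ℤ, vpow (m * e) = vpow m ^ e := fun m => by
      rw [vpow, vpow, zpow_mul, zpow_natCast]
    rw [svD_one β hβ, map_mul, map_mul, map_mul, map_pow, map_mul, psi2D_algebraMap,
      psi2D_algebraMap, psi2D_wv', hb', h1, C.map_mul, C.map_mul, C.map_pow]
    ring
  · exact ((isBracketMonomial_sign hε).mul (isBracketMonomial_vpow _)).mul hm

include hmul hgen in
lemma HasForm.bracket_inner (hβ : isSpecD β) {W : List ℕ} {x : UD n} {σ : ℤ}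
    (hx : HasForm Ψ M β W x σ) (L : ℕ) (hL : 2 ≤ L ∧ L + 2 < n)
    (hWp : W.count (L - 1) = 1) (hWL : W.count L = 1) (hWs : W.count (L + 1) = 2)
    (r : ℤ) (hr : 0 ≤ r + M) (a : KK) (ha : IsVpow a) :
    HasForm Ψ M β (W ++ [L]) (x * genD n L r - a • (genD n L r * x)) (σ + r) := by
  obtain ⟨l, rfl⟩ : ∃ l : Fin n, L = l.1 + 1 := ⟨⟨L - 1, by omega⟩, by simp only; omega⟩
  rw [Nat.add_sub_cancel] at hWp
  have hS : ({l.1, l.1 + 1, l.1 + 2} : Finset ℕ) ⊆ Finset.Icc 1 n := by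
    intro c
    simp only [Finset.mem_insert, Finset.mem_singleton, Finset.mem_Icc]
    omega
  have hS1 : ∀ c ∈ ({l.1, l.1 + 1, l.1 + 2} : Finset ℕ), aD n c (l.1 + 1) ≠ 0 := by
    intro c
    simp only [Finset.mem_insert, Finset.mem_singleton]
    unfold aD
    split_ifs <;> omega
  have hS2 : ∀ c ∈ Finset.Icc 1 n, c ∉ ({l.1, l.1 + 1, l.1 + 2} : Finset ℕ) →
      aD n c (l.1 + 1) = 0 ∨ W.count c = 0 := by
    intro c
    simp only [Finset.mem_insert, Finset.mem_singleton]
    unfold aD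
    split_ifs <;> omega
  have h1 : l.1 ∉ ({l.1 + 1, l.1 + 2} : Finset ℕ) := by simp
  have h2 : l.1 + 1 ∉ ({l.1 + 2} : Finset ℕ) := by simp
  have hy : svD β (l.1 + 2) 1 = V _ 1 * svD β (l.1 + 1) 1 := by
    rw [svD_one β hβ, svD_one β hβ, ← mul_assoc, V_mul]
    congr 2; push_cast; ring_nf
  have hR : valR (svD β) (cnt n W) l = 0 := by
    rw [valR_cnt (svD β) W l _ hS hS1 hS2, Finset.prod_insert h1, Finset.prod_insert h2,
      Finset.prod_singleton, hWp, hWL, hWs, Finset.prod_range_succ _ 1,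
      aD_succ (c := l.1 + 2) rfl (by omega), neg_neg, hy, sub_self]
    ring
  have hLv : valL (svD β) (cnt n W) l = bFac β (l.1 + 1) * (V _ (2 - 2 * (l.1 + 1)) *
      algebraMap KK _ (vpow 1 * qBrack 1) * svD β (l.1 + 1) 1) *
        (svD β (l.1 + 1) 0 - svD β (l.1 + 1) 1) := by
    have h3 : V _ 1 * svD β (l.1 + 2) 0 = svD β (l.1 + 1) 0 := by
      rw [svD_zero β (by omega), svD_zero β (by omega), ← mul_assoc, V_mul]
      congr 2
    have h4 : V _ 1 * svD β l.1 0 - svD β (l.1 + 1) 1 = V _ (3 - (l.1 + 1)) *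
        (wv β - V _ (2 * (l.1 + 1) - 2 * n) * wv' β) := by
      rw [svD_zero β (by omega), svD_one β hβ, ← mul_assoc, V_mul, V_mul_sub_V_mul]
      congr 4 <;> push_cast <;> ring_nf
    have h5 : V _ (-2) * svD β (l.1 + 1) 0 - svD β (l.1 + 1) 1 = V _ (-1 - (l.1 + 1)) *
        (wv β - V _ (2 * (l.1 + 1) + 4 - 2 * n) * wv' β) := by
      rw [svD_zero β (by omega), svD_one β hβ, ← mul_assoc, V_mul, V_mul_sub_V_mul]
      congr 4 <;> push_cast <;> ring_nf
    have h6 : V (WR2D n) (2 - 2 * (l.1 + 1)) = V _ (3 - (l.1 + 1)) * V _ (-1 - (l.1 + 1)) := by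
      rw [V_mul]; congr 2; ring
    rw [valL_cnt (svD β) W l _ hS hS1 hS2, Finset.prod_insert h1, Finset.prod_insert h2,
      Finset.prod_singleton, hWp, hWL, hWs, Finset.prod_range_succ _ 1, Finset.prod_range_one,
      Finset.prod_range_one, Finset.prod_range_one,
      aD_succ (c := l.1 + 2) rfl (by omega), aD_pred (c := l.1) rfl (by omega), aD_self,
      neg_neg, hy, V_one_mul_sub, h3, h4, h5, h6, bFac]
    push_cast
    ring
  refine hx.bracket_of_one hmul hgen hβ l (by omega) hWL (by omega)
    (by change 0 < W.count (l.1 + 1 + 1); omega) r hr a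
    (-algebraMap KK _ a * (V _ (2 - 2 * (l.1 + 1)) *
      algebraMap KK _ (vpow 1 * qBrack 1) * svD β (l.1 + 1) 1)) (by rw [hR, hLv]; ring)
    (-1 * a * (vpow (2 - 2 * (l.1 + 1)) * (vpow 1 * qBrack 1) * vpow ((l.1 + 1 : ℕ) + 3 - 2 * n)))
    ?_ ?_
  · rw [svD_one β hβ]
    simp only [map_mul, map_neg, psi2D_algebraMap, psi2D_wv', map_one]
    ring
  · exact (((isBracketMonomial_sign (Or.inr rfl)).mul ha.isBracketMonomial).mul
      (((isBracketMonomial_vpow _).mul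
        ((isBracketMonomial_vpow 1).mul isBracketMonomial_qBrack)).mul (isBracketMonomial_vpow _)))

include hmul hgen in
lemma HasForm.bracket_branch (hβ : isSpecD β) {W : List ℕ} {x : UD n} {σ : ℤ}
    (hx : HasForm Ψ M β W x σ) (L : ℕ) (hL : 2 ≤ L ∧ L + 2 = n)
    (hWp : W.count (L - 1) = 1) (hWL : W.count L = 1) (hWs : W.count (L + 1) = 1)
    (hWn : W.count n = 1) (r : ℤ) (hr : 0 ≤ r + M) (a : KK) (ha : IsVpow a) :
    HasForm Ψ M β (W ++ [L]) (x * genD n L r - a • (genD n L r * x)) (σ + r) := by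
  obtain ⟨l, rfl⟩ : ∃ l : Fin n, L = l.1 + 1 := ⟨⟨L - 1, by omega⟩, by simp only; omega⟩
  rw [Nat.add_sub_cancel] at hWp
  have hn : (n : ℤ) = l.1 + 3 := by omega
  have hS : ({l.1, l.1 + 1, l.1 + 2, n} : Finset ℕ) ⊆ Finset.Icc 1 n := by
    intro c
    simp only [Finset.mem_insert, Finset.mem_singleton, Finset.mem_Icc]
    omega
  have hS1 : ∀ c ∈ ({l.1, l.1 + 1, l.1 + 2, n} : Finset ℕ), aD n c (l.1 + 1) ≠ 0 := by
    intro c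
    simp only [Finset.mem_insert, Finset.mem_singleton]
    unfold aD
    split_ifs <;> omega
  have hS2 : ∀ c ∈ Finset.Icc 1 n, c ∉ ({l.1, l.1 + 1, l.1 + 2, n} : Finset ℕ) →
      aD n c (l.1 + 1) = 0 ∨ W.count c = 0 := by
    intro c
    simp only [Finset.mem_insert, Finset.mem_singleton]
    unfold aD
    split_ifs <;> omega
  have h1 : l.1 ∉ ({l.1 + 1, l.1 + 2, n} : Finset ℕ) := by
    simp only [Finset.mem_insert, Finset.mem_singleton]; omega
  have h2 : l.1 + 1 ∉ ({l.1 + 2, n} : Finset ℕ) := by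
    simp only [Finset.mem_insert, Finset.mem_singleton]; omega
  have h3 : l.1 + 2 ∉ ({n} : Finset ℕ) := by
    simp only [Finset.mem_singleton]; omega
  have e0 : svD β l.1 0 = V _ (4 - n) * wv β := by
    rw [svD_zero β (by omega)]; congr 2; rw [hn]; ring_nf
  have e1 : svD β (l.1 + 1) 0 = V _ (3 - n) * wv β := by
    rw [svD_zero β (by omega)]; congr 2; rw [hn]; push_cast; ring_nf
  have e2 : svD β (l.1 + 2) 0 = V _ (2 - n) * wv β := by
    rw [svD_zero β (by omega)]; congr 2; rw [hn]; push_cast; ring_nf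
  have e3 : svD β n 0 = V _ (2 - n) * wv β := svD_zero_last β
  have ez : svD β (l.1 + 1) 1 = V _ (1 - n) * wv' β := by
    rw [svD_one β hβ]; congr 2; rw [hn]; push_cast; ring_nf
  set w := wv β
  set w' := wv' β
  have hself : svD β (l.1 + 1) 0 - svD β (l.1 + 1) 1 = V _ (3 - n) * (w - V _ (-2) * w') := by
    rw [e1, ez, V_mul_sub_V_mul]; ring_nf
  have hbF : bFac β (l.1 + 1) = (w - w') * (w - V _ (-4) * w') := by
    have h : bFac β (l.1 + 1) = (w - V _ 0 * w') * (w - V _ (-4) * w') := by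
      unfold bFac
      congr 4 <;> rw [hn] <;> push_cast <;> ring_nf
    rw [h, V_zero, one_mul]
  have hR : valR (svD β) (cnt n W) l = bFac β (l.1 + 1) * (V _ (8 - 3 * n) * (w - w')) *
      (svD β (l.1 + 1) 0 - svD β (l.1 + 1) 1) := by
    have f0 : V _ (4 - n) * w - V _ 1 * (V _ (1 - n) * w') =
        V _ (4 - n) * (w - V _ (-2) * w') := by
      rw [← mul_assoc, V_mul, V_mul_sub_V_mul]; ring_nf
    have f1 : V _ (3 - n) * w - V _ (-2) * (V _ (1 - n) * w') =
        V _ (3 - n) * (w - V _ (-4) * w') := by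
      rw [← mul_assoc, V_mul, V_mul_sub_V_mul]; ring_nf
    have f2 : V _ (2 - n) * w - V _ 1 * (V _ (1 - n) * w') = V _ (2 - n) * (w - w') := by
      rw [← mul_assoc, V_mul]; ring_nf
    have f3 : V (WR2D n) (8 - 3 * n) = V _ (4 - n) * V _ (2 - n) * V _ (2 - n) := by
      rw [V_mul, V_mul]; ring_nf
    rw [valR_cnt (svD β) W l _ hS hS1 hS2, Finset.prod_insert h1, Finset.prod_insert h2,
      Finset.prod_insert h3, Finset.prod_singleton, hWp, hWL, hWs, hWn, Finset.prod_range_one,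
      Finset.prod_range_one, Finset.prod_range_one, Finset.prod_range_one,
      aD_succ (c := l.1 + 2) rfl (by omega), aD_pred (c := l.1) rfl (by omega), aD_self,
      aD_last (by omega), neg_neg, e0, e1, e2, e3, ez, f0, f1, f2, f3, ← e1, ← ez, hself, hbF]
    ring
  have hLv : valL (svD β) (cnt n W) l = bFac β (l.1 + 1) * (V _ (9 - 3 * n) *
      (w - V _ (-2) * w')) * (svD β (l.1 + 1) 0 - svD β (l.1 + 1) 1) := by
    have f0 : V _ 1 * (V _ (4 - n) * w) - V _ (1 - n) * w' =
        V _ (5 - n) * (w - V _ (-4) * w') := by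
      rw [← mul_assoc, V_mul, V_mul_sub_V_mul]; ring_nf
    have f1 : V _ (-2) * (V _ (3 - n) * w) - V _ (1 - n) * w' = V _ (1 - n) * (w - w') := by
      rw [← mul_assoc, V_mul]; ring_nf
    have f2 : V _ 1 * (V _ (2 - n) * w) - V _ (1 - n) * w' =
        V _ (3 - n) * (w - V _ (-2) * w') := by
      rw [← mul_assoc, V_mul, V_mul_sub_V_mul]; ring_nf
    have f3 : V (WR2D n) (9 - 3 * n) = V _ (5 - n) * V _ (1 - n) * V _ (3 - n) := by
      rw [V_mul, V_mul]; ring_nf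
    rw [valL_cnt (svD β) W l _ hS hS1 hS2, Finset.prod_insert h1, Finset.prod_insert h2,
      Finset.prod_insert h3, Finset.prod_singleton, hWp, hWL, hWs, hWn, Finset.prod_range_one,
      Finset.prod_range_one, Finset.prod_range_one, Finset.prod_range_one,
      aD_succ (c := l.1 + 2) rfl (by omega), aD_pred (c := l.1) rfl (by omega), aD_self,
      aD_last (by omega), neg_neg, hself, e0, e1, e2, e3, ez, f0, f1, f2, f3, hbF]
    ring
  have hc : vpow (9 - 3 * n) * (1 - vpow (-2)) = vpow (8 - 3 * n) * qBrack 1 := by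
    rw [qBrack, mul_sub, mul_sub, ← vpow_add, ← vpow_add, ← vpow_add, mul_one]
    push_cast
    ring_nf
  refine hx.bracket_of_one hmul hgen hβ l (by omega) hWL (by omega)
    (by change 0 < W.count (l.1 + 1 + 1); omega) r hr a
    (V _ (8 - 3 * n) * (w - w') - algebraMap KK _ a * (V _ (9 - 3 * n) * (w - V _ (-2) * w')))
    (by rw [hR, hLv]; ring) (-1 * a * (vpow (8 - 3 * n) * qBrack 1)) ?_ ?_
  · rw [← hc]
    simp only [map_mul, map_neg, map_sub, psi2D_algebraMap, psi2D_wv, psi2D_wv', map_one, w, w']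
    ring
  · exact ((isBracketMonomial_sign (Or.inr rfl)).mul ha.isBracketMonomial).mul
      ((isBracketMonomial_vpow _).mul isBracketMonomial_qBrack)

end Steps
end DoubledSteps

section Words
variable {n : ℕ}

lemma chainE_append {B : Type} [Ring B] [Module KK B] (g : ℕ → ℤ → B) {W : List ℕ} {ss : List ℤ}
    {ls : List KK} (hW : W ≠ []) (hs : ss.length = W.length) (hl : ls.length + 1 = W.length)
    (L : ℕ) (s : ℤ) (a : KK) :
    chainE g (W ++ [L]) (ss ++ [s]) (ls ++ [a]) =
      chainE g W ss ls * g L s - a • (g L s * chainE g W ss ls) := by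
  cases W with
  | nil => exact absurd rfl hW
  | cons c W =>
    cases ss with
    | nil => simp at hs
    | cons t ss =>
      simp only [List.length_cons, Nat.add_right_cancel_iff] at hs hl
      simp only [chainE, List.cons_append]
      rw [List.zip_append hs.symm, List.zip_append (by simp [hs, hl]), List.foldl_append]
      rfl

/-- every iterated bracket along the word `W` has the expected specialization at `β`. -/
def WordHasForm (Ψ : UD n →ₗ[KK] BigS n) (M : ℕ) (β : PosRootD n) (W : List ℕ) : Prop :=
  W ≠ [] ∧ ∀ (ss : List ℤ) (ls : List KK), ss.length = W.length → ls.length + 1 = W.length →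
    (∀ s ∈ ss, 0 ≤ s + M) → (∀ l ∈ ls, IsVpow l) →
      HasForm Ψ M β W (chainE (genD n) W ss ls) ss.sum

section Steps
variable {Ψ : UD n →ₗ[KK] BigS n}
  (hmul : ∀ a b, Ψ (a * b) = bstar n (aD n) (dD n) (Ψ a) (Ψ b))
  (hgen : ∀ (i : Fin n) (r : ℤ), Ψ (ug n (aD n) (dD n) i r) =
    DirectSum.of (fun k => Fk n k) (unitVec i)
      (xvr n (⟨i, ⟨0, by simp [unitVec]⟩⟩ : Vars n (unitVec i)) ^ r))
  {M : ℕ} {β : PosRootD n}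

include hgen in
lemma wordHasForm_singleton (L : ℕ) (hL : 1 ≤ L ∧ L ≤ n) : WordHasForm Ψ M β [L] := by
  refine ⟨by simp, fun ss ls hs hl hss _ => ?_⟩
  obtain ⟨s, rfl⟩ := List.length_eq_one_iff.mp hs
  obtain rfl : ls = [] := by simpa using hl
  simpa [chainE] using hasForm_gen Ψ hgen M β L hL s (hss s (by simp))

lemma WordHasForm.append {W : List ℕ} (h : WordHasForm Ψ M β W) (L : ℕ)
    (hstep : ∀ (x : UD n) (σ : ℤ), HasForm Ψ M β W x σ → ∀ r : ℤ, 0 ≤ r + M → ∀ a : KK,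
      IsVpow a → HasForm Ψ M β (W ++ [L]) (x * genD n L r - a • (genD n L r * x)) (σ + r)) :
    WordHasForm Ψ M β (W ++ [L]) := by
  refine ⟨by simp, fun ss ls hs hl hss hls => ?_⟩
  have hW := List.length_pos_iff.mpr h.1
  rw [List.length_append, List.length_singleton] at hs hl
  obtain rfl | ⟨ss, s, rfl⟩ := List.eq_nil_or_concat ss
  · simp at hs
  obtain rfl | ⟨ls, a, rfl⟩ := List.eq_nil_or_concat ls
  · simp only [List.length_nil] at hl; omega
  rw [List.concat_eq_append, List.length_append, List.length_singleton] at hs hl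
  rw [List.concat_eq_append] at hss hls
  rw [List.concat_eq_append, List.concat_eq_append,
    chainE_append _ h.1 (by omega) (by omega), List.sum_append, List.sum_singleton]
  exact hstep _ _ (h.2 ss ls (by omega) (by omega) (fun t ht => hss t (by simp [ht]))
    fun l hl' => hls l (by simp [hl'])) s (hss s (by simp)) a (hls a (by simp))

include hmul hgen in
lemma wordHasForm_range' (i t : ℕ) (hi : 1 ≤ i) (ht : i + t + 1 ≤ n) :
    WordHasForm Ψ M β (List.range' i (t + 1)) := by
  induction t with
  | zero => exact wordHasForm_singleton hgen i ⟨hi, by omega⟩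
  | succ t ih =>
    rw [List.range'_1_concat]
    refine (ih (by omega)).append _ fun x σ hx r hr a ha =>
      hx.bracket_of_zero hmul hgen _ (i + t) (by omega) (by omega) (aD_pred rfl ht)
        ?_ ?_ ?_ ?_ r hr a ha
    · rw [List.count_range_1', if_pos (by omega)]
    · rw [List.count_range_1', if_neg (by omega)]
    · intro c hc
      rw [List.count_range_1']
      unfold aD
      split_ifs <;> omega
    · rw [svD_zero β (by omega), svD_zero β (by omega), ← mul_assoc, V_mul]
      congr 2; push_cast; ring

include hmul hgen in
lemma wordHasForm_range'_last (i : ℕ) (hi : 1 ≤ i) (hin : i + 2 ≤ n) :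
    WordHasForm Ψ M β (List.range' i (n - 1 - i) ++ [n]) := by
  obtain ⟨m, rfl⟩ : ∃ m, n = i + m + 2 := ⟨n - 2 - i, by omega⟩
  rw [show i + m + 2 - 1 - i = m + 1 by omega]
  refine (wordHasForm_range' hmul hgen i m hi (by omega)).append _ fun x σ hx r hr a ha =>
    hx.bracket_of_zero hmul hgen _ (i + m) (by omega) (by omega) ?_ ?_ ?_ ?_ ?_ r hr a ha
  · unfold aD; split_ifs <;> omega
  · rw [List.count_range_1', if_pos (by omega)]
  · rw [List.count_range_1', if_neg (by omega)]
  · intro c hc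
    rw [List.count_range_1']
    unfold aD
    split_ifs <;> omega
  · rw [svD_zero β (by omega), svD_zero_last, ← mul_assoc, V_mul]
    congr 2; push_cast; ring

include hmul hgen in
lemma wordHasForm_descending_one (i : ℕ) (hi : 1 ≤ i) (hin : i + 2 ≤ n) :
    WordHasForm Ψ M β (List.range' i (n - 1 - i) ++ [n] ++ [n - 1]) := by
  obtain ⟨m, rfl⟩ : ∃ m, n = i + m + 2 := ⟨n - 2 - i, by omega⟩
  refine (wordHasForm_range'_last hmul hgen i hi (by omega)).append _ fun x σ hx r hr a ha =>
    hx.bracket_of_zero hmul hgen _ (i + m) (by omega) (by omega) (aD_pred (by omega) (by omega))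
      ?_ ?_ ?_ ?_ r hr a ha
  · rw [List.count_append, List.count_range_1', List.count_singleton, if_pos (by omega)]
    simp only [beq_iff_eq]
    rw [if_neg (by omega)]
  · rw [List.count_append, List.count_range_1', List.count_singleton, if_neg (by omega)]
    simp only [beq_iff_eq]
    rw [if_neg (by omega)]
  · intro c hc
    rw [List.count_append, List.count_range_1', List.count_singleton]
    simp only [beq_iff_eq]
    unfold aD
    split_ifs <;> omega
  · rw [svD_zero β (by omega), svD_zero β (by omega), ← mul_assoc, V_mul]
    congr 2; push_cast [show i + m + 2 - 1 = i + m + 1 by omega]; ring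

include hmul hgen in
lemma wordHasForm_descending (hβ : isSpecD β) (i d : ℕ) (hi : 1 ≤ i) (hd : i + d + 2 ≤ n) :
    WordHasForm Ψ M β
      (List.range' i (n - 1 - i) ++ [n] ++ (List.range' (n - (d + 1)) (d + 1)).reverse) := by
  induction d with
  | zero => simpa using wordHasForm_descending_one hmul hgen i hi (by omega)
  | succ d ih =>
    rw [List.range'_succ, List.reverse_cons, ← List.append_assoc,
      show n - (d + 1 + 1) + 1 = n - (d + 1) by omega]
    have hc : ∀ c, (List.range' i (n - 1 - i) ++ [n] ++
        (List.range' (n - (d + 1)) (d + 1)).reverse).count c =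
        (if i ≤ c ∧ c < n - 1 then 1 else 0) + (if n = c then 1 else 0) +
          (if n - (d + 1) ≤ c ∧ c < n then 1 else 0) := by
      intro c
      rw [List.count_append, List.count_append, List.count_reverse, List.count_range_1',
        List.count_range_1', List.count_singleton, show i + (n - 1 - i) = n - 1 by omega,
        show n - (d + 1) + (d + 1) = n by omega]
      simp only [beq_iff_eq]
    refine (ih (by omega)).append _ fun x σ hx r hr a ha => ?_
    rcases Nat.eq_zero_or_pos d with rfl | hd0
    · refine hx.bracket_branch hmul hgen hβ _ (by omega) ?_ ?_ ?_ ?_ r hr a ha <;>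
      · rw [hc]
        split_ifs <;> omega
    · refine hx.bracket_inner hmul hgen hβ _ (by omega) ?_ ?_ ?_ r hr a ha <;>
      · rw [hc]
        split_ifs <;> omega

end Steps
end Words

section RootWords
variable {n : ℕ}

lemma root_bounds (β : PosRootD n) : 1 ≤ riD β ∧ riD β ≤ n ∧ (n - 1 ≤ riD β → rtD β = 0) ∧
    (rtD β = 0 ∨ rtD β + 2 * riD β + 1 ≤ 2 * n) :=
  ⟨β.2.1, Nat.le_of_lt_succ (ofLex β.1).1.2, β.2.2.1, β.2.2.2⟩

lemma count_wordD (β : PosRootD n) (c : ℕ) : (wordD β).count c = nuD β c := by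
  obtain ⟨h1, h2, h3, h4⟩ := root_bounds β
  unfold wordD nuD
  generalize riD β = i at *
  generalize rtD β = t at *
  dsimp only
  split_ifs <;>
  simp only [List.count_append, List.count_reverse, List.count_range_1', List.count_cons,
    List.count_nil, beq_iff_eq] <;>
  split_ifs <;> omega

lemma cnt_wordD (β : PosRootD n) : cnt n (wordD β) = nuVecD n β :=
  funext fun i => count_wordD β (i.1 + 1)

lemma bWord_wordD (β : PosRootD n) : bWord β (wordD β) = BoneD n β 0 := by
  obtain ⟨h1, h2, h3, h4⟩ := root_bounds β
  have hs : isSpecD β ↔ n + 2 ≤ riD β + rtD β := Iff.rfl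
  unfold bWord BoneD
  simp only [count_wordD]
  split_ifs with hβ
  · rw [← Finset.prod_filter]
    refine Finset.prod_congr ?_ fun c _ => ?_
    · ext c
      rw [hs] at hβ
      simp only [Finset.mem_filter, Finset.mem_Icc]
      unfold nuD
      dsimp only
      split_ifs <;> omega
    · simp only [bFac, V, wv, wv', MvPolynomial.algebraMap_eq]
  · refine Finset.prod_eq_one fun c _ => if_neg ?_
    rw [hs] at hβ
    unfold nuD
    dsimp only
    split_ifs <;> omega

lemma bProdD_dOne (β : PosRootD n) : BprodD n (dOne β) = BoneD n β 0 := by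
  unfold BprodD
  rw [Finset.prod_eq_single β]
  · simp [dOne]
  · intro γ _ h
    simp [dOne, h]
  · simp

lemma slots_dOne (β : PosRootD n) (c : ℕ) :
    slots (nuD (n := n)) (dOne β) c = (List.range (nuD β c)).map fun t => (β, 0, t) := by
  unfold slots
  have key : ∀ l : List (PosRootD n), l.Nodup → (l.flatMap fun γ =>
      (List.range (dOne β γ)).flatMap fun s => (List.range (nuD γ c)).map fun t => (γ, s, t)) =
      if β ∈ l then (List.range (nuD β c)).map fun t => (β, 0, t) else [] := by
    intro l hl
    induction l with
    | nil => rfl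
    | cons γ l ih =>
      rw [List.nodup_cons] at hl
      rw [List.flatMap_cons, ih hl.2]
      by_cases h : γ = β
      · subst h
        simp [dOne, hl.1]
      · simp [dOne, h, Ne.symm h]
  rw [key _ (Finset.sort_nodup _ _), if_pos (by simp)]

lemma phi1subD_dOne (β : PosRootD n) :
    (phi1subD n (dOne β) : Vars n (nuVecD n β) → WR2D n) = pt (svD β) (nuVecD n β) := by
  funext u
  have hu : u.2.1 < nuD β (u.1.1 + 1) := u.2.2
  simp [phi1subD, slots_dOne, pt, hu]

lemma exists_psi2D_svD (β : PosRootD n) (c t : ℕ) :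
    ∃ m : ℤ, psi2D n (svD β c t) = C (vpow m) * X (β, 0) := by
  unfold svD specValD
  split_ifs <;> exact ⟨_, by simp [psi2D, MvPolynomial.algebraMap_eq]; rfl⟩

lemma card_vars_cnt (W : List ℕ) (hW : ∀ c ∈ W, 1 ≤ c ∧ c ≤ n) :
    Fintype.card (Vars n (cnt n W)) = W.length := by
  rw [Fintype.card_sigma]
  have h1 : ∀ i : Fin n, Fintype.card (Fin (cnt n W i)) = W.count (i.1 + 1) := fun i =>
    Fintype.card_fin _
  simp only [h1]
  rw [Fin.sum_univ_eq_sum_range (fun i => W.count (i + 1)) n, Finset.range_eq_Ico,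
    Finset.sum_Ico_add' (fun c => W.count c) 0 n 1]
  have h := Multiset.sum_count_eq_card (s := Finset.Ico (0 + 1) (n + 1)) (m := (W : Multiset ℕ))
    fun c hc => by
      have := hW c (by simpa using hc)
      simp only [Finset.mem_Ico]
      omega
  simpa using h

lemma card_vars_nuVecD (β : PosRootD n) : Fintype.card (Vars n (nuVecD n β)) = heightD β := by
  rw [← cnt_wordD, card_vars_cnt, heightD]
  intro c hc
  rw [← List.count_pos_iff, count_wordD] at hc
  obtain ⟨h1, h2, h3, h4⟩ := root_bounds β
  unfold nuD at hc
  dsimp only at hc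
  split_ifs at hc <;> omega

lemma exists_psi2D_xProd (β : PosRootD n) (M : ℕ) (k : Fin n → ℕ) : ∃ u : ℤ,
    psi2D n (aeval (pt (svD β) k) (xProd n k ^ M)) =
      C (vpow u) * X (β, 0) ^ (Fintype.card (Vars n k) * M) := by
  have h : ∀ s : Finset (Vars n k), ∃ u : ℤ,
      ∏ i ∈ s, psi2D n (pt (svD β) k i) = C (vpow u) * X (β, 0) ^ s.card := by
    intro s
    induction s using Finset.cons_induction with
    | empty => exact ⟨0, by simp [vpow_zero]⟩
    | cons i s hi ih =>
      obtain ⟨u, hu⟩ := ih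
      obtain ⟨m, hm⟩ := exists_psi2D_svD β (i.1.1 + 1) i.2.1
      refine ⟨m + u, ?_⟩
      rw [Finset.prod_cons, hu, pt, hm, Finset.card_cons, vpow_add, C.map_mul, pow_succ]
      ring
  obtain ⟨u, hu⟩ := h Finset.univ
  refine ⟨u * M, ?_⟩
  rw [map_pow, map_pow, xProd, map_prod, map_prod]
  simp only [MvPolynomial.aeval_X]
  rw [hu, mul_pow, ← pow_mul, ← C.map_pow, vpow, vpow, zpow_mul, zpow_natCast, Finset.card_univ]

section Main
variable {Ψ : UD n →ₗ[KK] BigS n}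
  (hmul : ∀ a b, Ψ (a * b) = bstar n (aD n) (dD n) (Ψ a) (Ψ b))
  (hgen : ∀ (i : Fin n) (r : ℤ), Ψ (ug n (aD n) (dD n) i r) =
    DirectSum.of (fun k => Fk n k) (unitVec i)
      (xvr n (⟨i, ⟨0, by simp [unitVec]⟩⟩ : Vars n (unitVec i)) ^ r))
  {M : ℕ}

include hmul hgen in
lemma wordHasForm_wordD (β : PosRootD n) : WordHasForm Ψ M β (wordD β) := by
  obtain ⟨h1, h2, h3, h4⟩ := root_bounds β
  have hs : isSpecD β ↔ n + 2 ≤ riD β + rtD β := Iff.rfl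
  unfold wordD
  generalize riD β = i at *
  generalize rtD β = t at *
  dsimp only
  split_ifs with h h' h''
  · obtain rfl | hi := eq_or_ne i n
    · rw [h3 (by omega)]
      exact wordHasForm_singleton hgen i ⟨h1, le_rfl⟩
    · exact wordHasForm_range' hmul hgen i t h1 (by omega)
  · exact wordHasForm_range'_last hmul hgen i h1 (by omega)
  · simpa using wordHasForm_descending_one hmul hgen i h1 (by omega)
  · have := wordHasForm_descending (M := M) hmul hgen (hs.mpr (by omega)) i
      (n - (2 * n - i - t) - 1) h1 (by omega)
    rwa [show n - (2 * n - i - t) - 1 + 1 = n - (2 * n - i - t) by omega,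
      show n - (n - (2 * n - i - t)) = 2 * n - i - t by omega] at this

lemma cwD_eq (a : KK) : cwD n a = algebraMap (WRD n) (FWD n) (C a) := by
  unfold cwD
  rw [IsScalarTower.algebraMap_apply KK (WRD n) (FWD n)]
  rfl

lemma HasForm.phiRelD {β : PosRootD n} {x : UD n} {σ : ℤ} (hx : HasForm Ψ M β (wordD β) x σ) :
    ∃ (c : ℚ) (m : ℤ), c ≠ 0 ∧
      PhiRelD n (dOne β) ((Ψ x) (nuVecD n β))
        (cwD n (algebraMap ℚ KK c * vpow m * qBrack 1 ^ (heightD β - 1)) *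
          wXD n (β, 0) ^ (σ + (heightD β : ℤ) - 1)) := by
  obtain ⟨q, a, j, p, hS, hq, ⟨c, m, hc, rfl⟩, hj, hp⟩ := hx
  rw [cnt_wordD] at hS
  obtain ⟨F, g, hF, -, hg, hG⟩ := hS
  obtain ⟨u, hu⟩ := exists_psi2D_xProd β M (nuVecD n β)
  have hw : wXD n (β, 0) ≠ 0 := by
    rw [wXD, Ne, FaithfulSMul.algebraMap_eq_zero_iff]
    exact MvPolynomial.X_ne_zero _
  refine ⟨c, m - u, hc, M, g, q, ?_, ?_, ?_⟩
  · rw [hF, DirectSum.of_eq_same, hg]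
  · rw [phi1subD_dOne, hG, bProdD_dOne, bWord_wordD]
  · have e1 : vpow (m - u) * vpow u = vpow m := by rw [← vpow_add, sub_add_cancel]
    have e2 : wXD n (β, 0) ^ (σ + (heightD β : ℤ) - 1) * wXD n (β, 0) ^ (heightD β * M) =
        wXD n (β, 0) ^ p := by
      rw [← zpow_natCast, ← zpow_natCast, ← zpow_add₀ hw]
      congr 1
      rw [heightD]
      push_cast
      linarith
    rw [phi1subD_dOne, hu, hq, card_vars_nuVecD, map_mul, map_mul, map_pow, map_pow, ← cwD_eq,
      ← cwD_eq, ← wXD, ← e1, ← e2, show heightD β - 1 = j by rw [heightD]; omega]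
    simp only [cwD, map_mul, map_pow]
    ring

lemma exists_nonneg_add (ss : List ℤ) : ∃ M : ℕ, ∀ s ∈ ss, 0 ≤ s + M := by
  induction ss with
  | nil => exact ⟨0, by simp⟩
  | cons t ss ih =>
    obtain ⟨M, hM⟩ := ih
    refine ⟨M + t.natAbs, fun s hs => ?_⟩
    rcases List.mem_cons.mp hs with rfl | hs
    · omega
    · have := hM s hs
      omega

end Main
end RootWords

end SpecializationHelpers

/-- **Specialization of quantum root vectors (type `D_n`)**: for every `β ∈ Δ⁺`, `s ∈ ℤ` and
any choices of the parameters `λ ∈ v^ℤ` and of decompositions defining the quantum root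
vector `E_{β,s}`, there are `c ∈ ℚ^×` and `m ∈ ℤ` with
`φ_β(Ψ(E_{β,s})) = c·v^m·⟨1⟩_v^{|β|-1}·w_{β,1}^{s+|β|-1}`.  Here `Ψ` is the homomorphism to
the shuffle algebra determined by `e_{i,r} ↦ x_{i,1}^r` and `φ_β` is the specialization map
(encoded by the graph relation `PhiRelD`). -/
theorem specialization_root_vectors_typeD (n : ℕ) (hn : 4 ≤ n)
    (Ψ : UA n (aD n) (dD n) →ₗ[KK] BigS n)
    (hmul : ∀ a b, Ψ (a * b) = bstar n (aD n) (dD n) (Ψ a) (Ψ b))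
    (hone : Ψ 1 = DirectSum.of (fun k => Fk n k) 0 1)
    (hgen : ∀ (i : Fin n) (r : ℤ),
      Ψ (ug n (aD n) (dD n) i r) =
        DirectSum.of (fun k => Fk n k) (unitVec i)
          (xvr n (⟨i, ⟨0, by simp [unitVec]⟩⟩ : Vars n (unitVec i)) ^ r))
    (β : PosRootD n) (s : ℤ) (E : UD n) (hE : IsRVD β s E) :
    ∃ (c : ℚ) (m : ℤ), c ≠ 0 ∧
      PhiRelD n (dOne β) ((Ψ E) (nuVecD n β))
        (cwD n (algebraMap ℚ KK c * vpow m * qBrack 1 ^ (heightD β - 1)) *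
          wXD n (β, 0) ^ (s + (heightD β : ℤ) - 1)) := by
  obtain ⟨ss, ls, hss, hls, rfl, hl, rfl⟩ := hE
  obtain ⟨M, hM⟩ := exists_nonneg_add ss
  exact ((wordHasForm_wordD hmul hgen β).2 ss ls hss hls hM hl).phiRelD
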